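/- For every γ > 0 there are constants C and D such that if p ≥ C·(log n/n)^{1/2}, then a.a.s. Γ = G(n,p) has the following property: every spanning subgraph G ⊆ Γ obtained by deleting, at each vertex v, at most (1/3 − γ)·deg_Γ(v) of the edges incident to v, contains a collection of pairwise vertex-disjoint triangles covering all but at most D·p^{-2} vertices. In other words, the local resilience of G(n,p) with respect to containing an almost spanning triangle factor covering all but at most D·p^{-2} vertices is a.a.s. at least 1/3 − γ. -/

import Mathlib

open MeasureTheory Filter Topology

/-- Bernoulli measure on `Bool` with success probability `p` (clamped to `[0,1]`). -/
noncomputable def bernoulliMeasure (p : ℝ) : Measure Bool :=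
  (min (ENNReal.ofReal p) 1) • Measure.dirac true +
    (1 - min (ENNReal.ofReal p) 1) • Measure.dirac false

/-- The distribution of the binomial random graph `G(n,p)`, as a product of independent
Bernoulli measures, one for each potential edge. -/
noncomputable def gnp (n : ℕ) (p : ℝ) : Measure (Sym2 (Fin n) → Bool) :=
  Measure.pi fun _ => bernoulliMeasure p

/-- The simple graph on `[n]` determined by an outcome of the edge indicators. -/
def graphOf {n : ℕ} (ω : Sym2 (Fin n) → Bool) : SimpleGraph (Fin n) :=
  SimpleGraph.fromRel fun u v => ω s(u, v) = true

/-- `G` contains a (not necessarily induced) copy of `H`. -/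
def ContainsCopy {α β : Type*} (H : SimpleGraph α) (G : SimpleGraph β) : Prop :=
  ∃ f : α → β, Function.Injective f ∧ ∀ ⦃u v⦄, H.Adj u v → G.Adj (f u) (f v)

/-- The maximum degree of a graph on a finite vertex type. -/
noncomputable def maxDeg {V : Type*} [Fintype V] (G : SimpleGraph V) : ℕ :=
  Finset.univ.sup fun v => (G.neighborSet v).ncard

/-- The maximum 0-density `m₀(H)`. -/
noncomputable def m0 {V : Type*} [Fintype V] (H : SimpleGraph V) : ℝ :=
  sSup {x : ℝ | ∃ H' : H.Subgraph, H'.verts.Nonempty ∧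
    x = (H'.edgeSet.ncard : ℝ) / (H'.verts.ncard : ℝ)}

/-- The maximum 1-density `m₁(H)`. -/
noncomputable def m1 {V : Type*} [Fintype V] (H : SimpleGraph V) : ℝ :=
  sSup {x : ℝ | ∃ H' : H.Subgraph, 1 < H'.verts.ncard ∧
    x = (H'.edgeSet.ncard : ℝ) / ((H'.verts.ncard : ℝ) - 1)}

/-- The maximum 2-density `m₂(H)`. -/
noncomputable def m2 {V : Type*} [Fintype V] (H : SimpleGraph V) : ℝ :=
  sSup {x : ℝ | ∃ H' : H.Subgraph, 0 < H'.edgeSet.ncard ∧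
    x = if 2 < H'.verts.ncard
      then ((H'.edgeSet.ncard : ℝ) - 1) / ((H'.verts.ncard : ℝ) - 2)
      else 1 / 2}

/-- The maximum Riordan-density `m_R(H)`. -/
noncomputable def mR {V : Type*} [Fintype V] (H : SimpleGraph V) : ℝ :=
  sSup {x : ℝ | ∃ H' : H.Subgraph, 2 < H'.verts.ncard ∧
    x = (H'.edgeSet.ncard : ℝ) / ((H'.verts.ncard : ℝ) - 2)}

/-- The local 1-density `m₁(x,H)` of `H` at the vertex `x`. -/
noncomputable def m1At {V : Type*} [Fintype V] (H : SimpleGraph V) (x : V) : ℝ :=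
  sSup {r : ℝ | ∃ H' : H.Subgraph, x ∈ H'.verts ∧ 1 < H'.verts.ncard ∧
    r = (H'.edgeSet.ncard : ℝ) / ((H'.verts.ncard : ℝ) - 1)}

/-- `H` is strictly 1-balanced: `H` itself is the unique maximiser of the 1-density. -/
def StrictlyOneBalanced {V : Type*} [Fintype V] (H : SimpleGraph V) : Prop :=
  ∀ H' : H.Subgraph, 1 < H'.verts.ncard → H' ≠ ⊤ →
    (H'.edgeSet.ncard : ℝ) / ((H'.verts.ncard : ℝ) - 1) <
      (H.edgeSet.ncard : ℝ) / ((Fintype.card V : ℝ) - 1)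

/-- `H` is vertex-1-balanced: the local 1-density at every vertex equals `m₁(H)`. -/
def VertexOneBalanced {V : Type*} [Fintype V] (H : SimpleGraph V) : Prop :=
  ∀ x : V, m1At H x = m1 H

/-- `G` (an `n`-vertex graph) contains an `H`-factor: `⌊n / v(H)⌋` pairwise vertex-disjoint
copies of `H`. -/
def HasFactor {V : Type*} [Fintype V] (H : SimpleGraph V) {n : ℕ}
    (G : SimpleGraph (Fin n)) : Prop :=
  ∃ f : Fin (n / Fintype.card V) × V → Fin n, Function.Injective f ∧
    ∀ (i : Fin (n / Fintype.card V)) ⦃u v : V⦄, H.Adj u v → G.Adj (f (i, u)) (f (i, v))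

namespace BLS
open Finset
open scoped Classical

variable {V : Type*} [Fintype V]

/-- neighbourhood as a finset -/
noncomputable def nb (G : SimpleGraph V) (v : V) : Finset V := univ.filter (fun w => G.Adj v w)

lemma mem_nb {G : SimpleGraph V} {v w : V} : w ∈ nb G v ↔ G.Adj v w := by simp [nb]

/-- quasirandomness properties of the host graph -/
structure QR (Γ : SimpleGraph V) (n p ε K : ℝ) : Prop where
  deg : ∀ v, |((nb Γ v).card : ℝ) - n * p| ≤ ε * (n * p)
  disc : ∀ Y : Finset V,
    ((univ.filter (fun x => ¬ |((nb Γ x ∩ Y).card : ℝ) - p * Y.card| ≤ ε * (n * p))).card : ℝ) ≤ K / p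
  ldisc : ∀ x, ∀ A ⊆ nb Γ x,
    (((nb Γ x).filter (fun b => ¬ |((nb Γ b ∩ A).card : ℝ) - p * A.card| ≤ ε * (n * p ^ 2))).card : ℝ)
      ≤ K / p
  codeg : ∀ x y, x ≠ y → ((nb Γ x ∩ nb Γ y).card : ℝ) ≤ 8 * (n * p ^ 2)

structure Setup (Γ G : SimpleGraph V) (n p ε K g : ℝ) : Prop where
  card : (Fintype.card V : ℝ) = n
  p0 : 0 < p
  p1 : p ≤ 1
  e0 : 0 < ε
  eg : ε ≤ g / 10
  g0 : 0 < g
  g1 : g ≤ 1 / 6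
  K1 : 1 ≤ K
  big : 1600 * K ≤ n * p ^ 2
  qr : QR Γ n p ε K
  sub : G ≤ Γ
  hR : ∀ v, ((nb Γ v \ nb G v).card : ℝ) ≤ (1 / 3 - g) * (n * p)
  hG : ∀ v, (2 / 3 + g) * (n * p) ≤ ((nb G v).card : ℝ)

lemma sum_nb_comm (G : SimpleGraph V) (X Y : Finset V) :
    ∑ x ∈ X, ((nb G x ∩ Y).card : ℝ) = ∑ y ∈ Y, ((nb G y ∩ X).card : ℝ) := by
  have h1 : ∀ X Y : Finset V, ∀ x, ((nb G x ∩ Y).card : ℝ) = ∑ y ∈ Y, if G.Adj x y then (1:ℝ) else 0 := by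
    intro X Y x
    rw [Finset.sum_boole]
    congr 2
    ext y
    simp [mem_nb, and_comm]
  simp_rw [h1 X Y]
  simp_rw [h1 Y X]
  rw [Finset.sum_comm]
  simp_rw [G.adj_comm]

/-- weighted double counting -/
lemma card_pairs_le {α β : Type*} (X : Finset α) (Y : Finset β) (r : α → β → Prop) (b : ℝ)
    (h : ∀ y ∈ Y, ((X.filter (fun x => r x y)).card : ℝ) ≤ b) :
    ∑ x ∈ X, ((Y.filter (fun y => r x y)).card : ℝ) ≤ Y.card * b := by
  have : ∑ x ∈ X, ((Y.filter (fun y => r x y)).card : ℝ)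
      = ∑ y ∈ Y, ((X.filter (fun x => r x y)).card : ℝ) := by
    simp_rw [← Finset.sum_boole]
    rw [Finset.sum_comm]
  rw [this]
  calc _ ≤ ∑ y ∈ Y, b := Finset.sum_le_sum h
    _ = _ := by simp

variable {Γ G : SimpleGraph V} {n p ε K g : ℝ}

namespace Setup

lemma n0 (h : Setup Γ G n p ε K g) : 0 < n := by
  have := h.big; have := h.K1; have := h.p0
  by_contra hn
  have : n * p ^ 2 ≤ 0 := mul_nonpos_of_nonpos_of_nonneg (by linarith) (by positivity)
  linarith

lemma np0 (h : Setup Γ G n p ε K g) : 0 < n * p := mul_pos h.n0 h.p0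

/-- `K/p` is tiny compared with `n p` -/
lemma Kp (h : Setup Γ G n p ε K g) : 1600 * (K / p) ≤ n * p := by
  have := h.p0
  rw [← mul_div_assoc, div_le_iff₀ this]
  have := h.big; nlinarith

lemma subnb (h : Setup Γ G n p ε K g) (v : V) : nb G v ⊆ nb Γ v := by
  intro w hw; rw [mem_nb] at *; exact h.sub hw

lemma degle (h : Setup Γ G n p ε K g) (v : V) : ((nb Γ v).card : ℝ) ≤ 2 * (n * p) := by
  have := (abs_le.1 (h.qr.deg v)).2
  have := h.np0; have := h.eg; have := h.g1
  nlinarith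

/-- `bad2 u x` -/
def bad2 (Γ G : SimpleGraph V) (n p ε : ℝ) (u x : V) : Prop :=
  x ∈ nb Γ u ∧ ¬ |((nb Γ x ∩ (nb Γ u \ nb G u)).card : ℝ) - p * (nb Γ u \ nb G u).card| ≤ ε * (n * p ^ 2)

lemma bad2_card (h : Setup Γ G n p ε K g) (u : V) :
    ((univ.filter (fun x => bad2 Γ G n p ε u x)).card : ℝ) ≤ K / p := by
  refine le_trans ?_ (h.qr.ldisc u (nb Γ u \ nb G u) sdiff_subset)
  gcongr
  intro x hx
  rw [mem_filter] at hx
  exact mem_filter.2 hx.2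

lemma not_bad2 (h : Setup Γ G n p ε K g) {u x : V} (hux : x ∈ nb Γ u) (hb : ¬ bad2 Γ G n p ε u x) :
    ((nb Γ x ∩ (nb Γ u \ nb G u)).card : ℝ) ≤ (1/3 - g + ε) * (n * p ^ 2) := by
  unfold bad2 at hb
  push Not at hb
  have h1 := (abs_le.1 (hb hux)).2
  have h2 := mul_le_mul_of_nonneg_left (h.hR u) h.p0.le
  nlinarith

/-- the set of vertices `x` which see `S` properly -/
noncomputable def goodX (Γ G : SimpleGraph V) (n p ε : ℝ) (S : Finset V) : Finset V :=
  univ.filter (fun x => p * S.card / 20 ≤ ((nb G x ∩ S).card : ℝ) ∧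
    ((S.filter (fun u => bad2 Γ G n p ε u x)).card : ℝ) ≤ p * S.card / 80)

/-- edges between a set `S` and a set `L` -/
lemma edges_le (h : Setup Γ G n p ε K g) (S L : Finset V) :
    ∑ u ∈ S, ((nb Γ u ∩ L).card : ℝ) ≤ S.card * (p * L.card + ε * (n * p)) + 2 * K * n := by
  set B := univ.filter (fun x => ¬ |((nb Γ x ∩ L).card : ℝ) - p * L.card| ≤ ε * (n * p)) with hB
  have hBc := h.qr.disc L
  rw [← hB] at hBc
  have h1 : ∀ u ∈ S, ((nb Γ u ∩ L).card : ℝ) ≤ (p * L.card + ε * (n * p)) +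
      (if u ∈ B then 2 * (n * p) else 0) := by
    intro u _
    by_cases hu : u ∈ B
    · have h2 : ((nb Γ u ∩ L).card : ℝ) ≤ (nb Γ u).card := by
        exact_mod_cast card_le_card inter_subset_left
      have h3 := h.degle u
      have h4 : 0 ≤ p * L.card + ε * (n * p) := by
        have := h.p0; have := h.e0; have := h.n0; positivity
      simp only [hu, if_true]; linarith
    · simp only [hu, if_false, add_zero]
      simp only [hB, mem_filter, mem_univ, true_and, not_not] at hu
      linarith [(abs_le.1 hu).2]
  refine (sum_le_sum h1).trans ?_
  rw [sum_add_distrib]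
  simp only [sum_const, nsmul_eq_mul]
  have h5 : ∑ u ∈ S, (if u ∈ B then 2 * (n * p) else 0) ≤ B.card * (2 * (n * p)) := by
    rw [← Finset.sum_filter, sum_const, nsmul_eq_mul]
    have := h.np0
    gcongr
    intro x; simp
  have h6 : (B.card : ℝ) * (2 * (n * p)) ≤ K / p * (2 * (n * p)) := by
    have := h.np0
    gcongr
  have h7 : K / p * (2 * (n * p)) = 2 * K * n := by
    have := h.p0.ne'
    field_simp
  linarith

lemma goodX_card (h : Setup Γ G n p ε K g) (S : Finset V) (hS : 2 * K / ε ≤ p ^ 2 * S.card) :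
    55 / 100 * n ≤ ((goodX Γ G n p ε S).card : ℝ) := by
  have hp := h.p0
  have hn := h.n0
  have he := h.e0
  have hK := h.K1
  have hp1 := h.p1
  have hScard : (0:ℝ) < S.card := by
    have : 0 < p ^ 2 * (S.card:ℝ) := lt_of_lt_of_le (by positivity) hS
    by_contra hc
    have : (S.card:ℝ) = 0 := le_antisymm (not_lt.1 hc) (by positivity)
    simp [this] at *
  have hpS : 2 * K ≤ ε * (p * S.card) := by
    have : 2 * K ≤ p ^ 2 * S.card * ε := by rwa [div_le_iff₀ he] at hS
    have h2 : p ^ 2 * S.card ≤ p * S.card := by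
      have : p ^ 2 ≤ p := by nlinarith
      gcongr
    nlinarith
  set L0 := univ.filter (fun x => p * S.card / 20 ≤ ((nb G x ∩ S).card : ℝ)) with hL0
  set J := univ.filter (fun x => p * S.card / 80 < ((S.filter (fun u => bad2 Γ G n p ε u x)).card : ℝ)) with hJ
  -- size of L0
  have hL0c : 60/100 * n ≤ L0.card := by
    have h1 : ∑ u ∈ S, ((nb G u).card : ℝ) = ∑ x, ((nb G x ∩ S).card : ℝ) := by
      rw [sum_nb_comm]; simp
    have h2 : (S.card : ℝ) * ((2 / 3 + g) * (n * p)) ≤ ∑ u ∈ S, ((nb G u).card : ℝ) := by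
      rw [← nsmul_eq_mul, ← sum_const]
      exact sum_le_sum (fun u _ => h.hG u)
    have h3 : ∑ x, ((nb G x ∩ S).card : ℝ) = ∑ x ∈ L0, ((nb G x ∩ S).card : ℝ)
        + ∑ x ∈ univ.filter (fun x => ¬ p * S.card / 20 ≤ ((nb G x ∩ S).card : ℝ)), ((nb G x ∩ S).card : ℝ) := by
      rw [hL0, sum_filter_add_sum_filter_not]
    have h4 : ∑ x ∈ univ.filter (fun x => ¬ p * S.card / 20 ≤ ((nb G x ∩ S).card : ℝ)), ((nb G x ∩ S).card : ℝ)
        ≤ n * (p * S.card / 20) := by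
      calc _ ≤ ∑ x ∈ univ.filter (fun x => ¬ p * S.card / 20 ≤ ((nb G x ∩ S).card : ℝ)), (p * S.card / 20) := by
            apply sum_le_sum
            intro x hx
            simp only [mem_filter, mem_univ, true_and, not_le] at hx
            exact hx.le
        _ ≤ ∑ x : V, (p * S.card / 20) := by
            apply sum_le_sum_of_subset_of_nonneg (subset_univ _)
            intros; positivity
        _ = _ := by simp [← h.card]
    have h5 : ∑ x ∈ L0, ((nb G x ∩ S).card : ℝ) ≤ ∑ u ∈ S, ((nb Γ u ∩ L0).card : ℝ) := by
      rw [sum_nb_comm]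
      apply sum_le_sum
      intro u _
      gcongr
      exact h.subnb u
    have h6 := h.edges_le S L0
    have h7 : 2 * K * n ≤ ε * (p * S.card) * n := by gcongr
    have h8 : (S.card : ℝ) * p * ((2/3 + g) * n) ≤ S.card * p * (L0.card + ε * n + ε * n + n / 20) := by
      nlinarith
    have h9 := le_of_mul_le_mul_left h8 (by positivity)
    have := h.eg; have := h.g0
    nlinarith
  have hJc : (J.card : ℝ) ≤ 5/100 * n := by
    have h1 := card_pairs_le J S (fun x u => bad2 Γ G n p ε u x) (K/p) (by
      intro u _
      refine le_trans ?_ (h.bad2_card u)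
      gcongr
      exact subset_univ J)
    have h2 : J.card * (p * S.card / 80) ≤ ∑ x ∈ J, ((S.filter (fun u => bad2 Γ G n p ε u x)).card : ℝ) := by
      rw [← nsmul_eq_mul, ← sum_const]
      apply sum_le_sum
      intro x hx
      simp only [hJ, mem_filter] at hx
      exact hx.2.le
    have h3 := h2.trans h1
    have h4 : (S.card:ℝ) * (J.card * p / 80) ≤ S.card * (K / p) := by nlinarith
    have h5 := le_of_mul_le_mul_left h4 hScard
    have h6 := h.Kp
    have h7 : (J.card:ℝ) * p / 80 ≤ n * p / 1600 := by linarith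
    have h8 : p * (J.card:ℝ) ≤ p * (5/100 * n) := by linarith
    exact le_of_mul_le_mul_left h8 hp
  have hsub : L0 \ J ⊆ goodX Γ G n p ε S := by
    intro x hx
    simp only [hL0, hJ, Finset.mem_sdiff, mem_filter, mem_univ, true_and, not_lt] at hx
    simp only [goodX, mem_filter, mem_univ, true_and]
    exact hx
  have h1 : (L0.card : ℝ) ≤ (L0 \ J).card + J.card := by
    exact_mod_cast card_le_card_sdiff_add_card
  have h2 : ((L0 \ J).card : ℝ) ≤ (goodX Γ G n p ε S).card := by exact_mod_cast card_le_card hsub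
  linarith

end Setup

/-- support -/
noncomputable def Ysup (G : SimpleGraph V) (S : Finset V) (x : V) : Finset V :=
  (nb G x).filter (fun y => ∃ u ∈ S, G.Adj u x ∧ G.Adj u y)

namespace Setup

lemma exists_of_card {S A B C : Finset V} (h : (A.card : ℝ) + B.card + C.card < S.card) :
    ∃ u ∈ S, u ∉ A ∧ u ∉ B ∧ u ∉ C := by
  by_contra hc
  push Not at hc
  have : S ⊆ A ∪ B ∪ C := by
    intro u hu
    have := hc u hu
    simp only [mem_union]
    tauto
  have h1 := card_le_card this
  have h2 := card_union_le (A ∪ B) C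
  have h3 := card_union_le A B
  have : (S.card : ℝ) ≤ A.card + B.card + C.card := by exact_mod_cast (by omega)
  linarith

lemma support (h : Setup Γ G n p ε K g) (S : Finset V) (hS : 200 * K ≤ p ^ 2 * S.card) {x : V}
    (hx : x ∈ goodX Γ G n p ε S) : (1 / 3 + g) * (n * p) ≤ ((Ysup G S x).card : ℝ) := by
  have hp := h.p0
  simp only [goodX, mem_filter, mem_univ, true_and] at hx
  set Y := Ysup G S x with hY
  have hYsub : Y ⊆ nb Γ x := (filter_subset _ _).trans (h.subnb x)
  have b1 := h.qr.ldisc x (nb G x) (h.subnb x)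
  have b3 := h.qr.ldisc x Y hYsub
  have hKpS : 200 * (K / p) ≤ p * S.card := by
    rw [← mul_div_assoc, div_le_iff₀ hp]; nlinarith
  have hKp0 : 0 < K / p := div_pos (by linarith [h.K1]) hp
  obtain ⟨u, hu, h1, h2, h3⟩ := exists_of_card
    (S := nb G x ∩ S) (A := S.filter (fun u => bad2 Γ G n p ε u x))
    (B := (nb Γ x).filter (fun b => ¬ |((nb Γ b ∩ nb G x).card : ℝ) - p * (nb G x).card| ≤ ε * (n * p ^ 2)))
    (C := (nb Γ x).filter (fun b => ¬ |((nb Γ b ∩ Y).card : ℝ) - p * Y.card| ≤ ε * (n * p ^ 2)))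
    (by linarith)
  rw [mem_inter] at hu
  have hux : u ∈ nb Γ x := h.subnb x hu.1
  have hxu : x ∈ nb Γ u := by rw [mem_nb] at *; exact hux.symm
  simp only [mem_filter, hu.2, hux, true_and, not_not] at h1 h2 h3
  have h4 := h.not_bad2 hxu h1
  have h2' := (abs_le.1 h2).1
  have h3' := (abs_le.1 h3).2
  -- nb Γ u ∩ nb G x ⊆ (nb Γ u ∩ Y) ∪ (nb Γ x ∩ R_u)
  have hsub : nb Γ u ∩ nb G x ⊆ (nb Γ u ∩ Y) ∪ (nb Γ x ∩ (nb Γ u \ nb G u)) := by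
    intro y hy
    rw [mem_inter] at hy
    by_cases hyu : y ∈ nb G u
    · apply mem_union_left
      rw [mem_inter]
      refine ⟨hy.1, ?_⟩
      rw [hY, Ysup, mem_filter]
      refine ⟨hy.2, u, hu.2, ?_, ?_⟩
      · rw [mem_nb] at hu; exact hu.1.symm
      · rwa [mem_nb] at hyu
    · apply mem_union_right
      rw [mem_inter, Finset.mem_sdiff]
      exact ⟨h.subnb x hy.2, hy.1, hyu⟩
  have hc : ((nb Γ u ∩ nb G x).card : ℝ) ≤ (nb Γ u ∩ Y).card + (nb Γ x ∩ (nb Γ u \ nb G u)).card := by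
    exact_mod_cast (card_le_card hsub).trans (card_union_le _ _)
  have hd := mul_le_mul_of_nonneg_left (h.hG x) hp.le
  have he := h.eg
  have hn2 : 0 < n * p ^ 2 := mul_pos h.n0 (by positivity)
  have : p * ((1 / 3 + g) * (n * p)) ≤ p * Y.card := by
    have hg := h.g0
    nlinarith [mul_pos hn2 hg, mul_le_mul_of_nonneg_right he hn2.le]
  exact le_of_mul_le_mul_left this hp

end Setup

/-- ordered triangles -/
noncomputable def tri (G : SimpleGraph V) : Finset (V × V × V) :=
  univ.filter (fun t => G.Adj t.1 t.2.1 ∧ G.Adj t.1 t.2.2 ∧ G.Adj t.2.1 t.2.2)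

noncomputable def Hset (G : SimpleGraph V) (S Z : Finset V) : Finset (V × V × V) :=
  (tri G).filter (fun t => t.2.2 ∈ Z ∧ ∃ u ∈ S, G.Adj u t.1 ∧ G.Adj u t.2.1)

namespace Setup

lemma reach (h : Setup Γ G n p ε K g) (S Z : Finset V) (hS : 200 * K ≤ p ^ 2 * S.card)
    (hS' : 2 * K / ε ≤ p ^ 2 * S.card) (hbig' : 8 * K / ε ≤ n * p ^ 2) (hZ : n / 4 ≤ Z.card) :
    g / 1600 * (n ^ 3 * p ^ 3) ≤ ((Hset G S Z).card : ℝ) := by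
  have hp := h.p0
  have hn := h.n0
  have hZ' : 2 * K / ε ≤ p ^ 2 * Z.card := by
    have : p ^ 2 * (n / 4) ≤ p ^ 2 * Z.card := by gcongr
    have e : 8 * K / ε = 4 * (2 * K / ε) := by ring
    nlinarith
  set X := goodX Γ G n p ε S ∩ goodX Γ G n p ε Z with hX
  have hXc : n / 10 ≤ X.card := by
    have h1 := h.goodX_card S hS'
    have h2 := h.goodX_card Z hZ'
    have h3 := card_inter_add_card_union (goodX Γ G n p ε S) (goodX Γ G n p ε Z)
    have h4 : ((goodX Γ G n p ε S ∪ goodX Γ G n p ε Z).card : ℝ) ≤ n := by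
      rw [← h.card]; exact_mod_cast card_le_univ _
    have h3' : (X.card : ℝ) + (goodX Γ G n p ε S ∪ goodX Γ G n p ε Z).card
      = (goodX Γ G n p ε S).card + (goodX Γ G n p ε Z).card := by exact_mod_cast h3
    linarith
  -- per x
  have hper : ∀ x ∈ X, ∃ W : Finset V, W ⊆ nb G x ∩ Z ∧ p * n / 160 ≤ (W.card : ℝ) ∧
      ∀ z ∈ W, g * (n * p ^ 2) ≤ ((nb G z ∩ Ysup G S x).card : ℝ) := by
    intro x hx
    rw [hX, mem_inter] at hx
    have hY := h.support S hS hx.1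
    have hxZ := hx.2
    simp only [goodX, mem_filter, mem_univ, true_and] at hxZ
    set Y := Ysup G S x with hYd
    have hYsub : Y ⊆ nb Γ x := (filter_subset _ _).trans (h.subnb x)
    have b3 := h.qr.ldisc x Y hYsub
    set B1 := Z.filter (fun u => bad2 Γ G n p ε u x)
    set B2 := (nb Γ x).filter (fun b => ¬ |((nb Γ b ∩ Y).card : ℝ) - p * Y.card| ≤ ε * (n * p ^ 2)) with hB2
    refine ⟨((nb G x ∩ Z) \ B1) \ B2, sdiff_subset.trans sdiff_subset, ?_, ?_⟩
    · have c1 : ((nb G x ∩ Z).card : ℝ) ≤ ((nb G x ∩ Z) \ B1).card + B1.card := by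
        exact_mod_cast card_le_card_sdiff_add_card
      have c2 : (((nb G x ∩ Z) \ B1).card : ℝ) ≤ (((nb G x ∩ Z) \ B1) \ B2).card + B2.card := by
        exact_mod_cast card_le_card_sdiff_add_card
      have c3 := h.Kp
      have c4 : p * (n / 4) ≤ p * Z.card := by gcongr
      nlinarith
    · intro z hz
      simp only [Finset.mem_sdiff, mem_inter] at hz
      obtain ⟨⟨⟨hzx, hzZ⟩, hz1⟩, hz2⟩ := hz
      have hzx' : z ∈ nb Γ x := h.subnb x hzx
      have hxz : x ∈ nb Γ z := by rw [mem_nb] at *; exact hzx'.symm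
      have hz1' : ¬ bad2 Γ G n p ε z x := fun hb => hz1 (mem_filter.2 ⟨hzZ, hb⟩)
      have hz2' : |((nb Γ z ∩ Y).card : ℝ) - p * Y.card| ≤ ε * (n * p ^ 2) := by
        by_contra hb; exact hz2 (mem_filter.2 ⟨hzx', hb⟩)
      have h4 := h.not_bad2 hxz hz1'
      have h5 := (abs_le.1 hz2').1
      have hsub : nb Γ z ∩ Y ⊆ (nb G z ∩ Y) ∪ (nb Γ x ∩ (nb Γ z \ nb G z)) := by
        intro y hy
        rw [mem_inter] at hy
        by_cases hyu : y ∈ nb G z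
        · exact mem_union_left _ (mem_inter.2 ⟨hyu, hy.2⟩)
        · exact mem_union_right _ (mem_inter.2 ⟨hYsub hy.2, Finset.mem_sdiff.2 ⟨hy.1, hyu⟩⟩)
      have hc : ((nb Γ z ∩ Y).card : ℝ) ≤ (nb G z ∩ Y).card + (nb Γ x ∩ (nb Γ z \ nb G z)).card := by
        exact_mod_cast (card_le_card hsub).trans (card_union_le _ _)
      have hd := mul_le_mul_of_nonneg_left hY hp.le
      have he := h.eg
      have hn2 : 0 < n * p ^ 2 := mul_pos h.n0 (by positivity)
      have hg := h.g0
      nlinarith [mul_pos hn2 hg, mul_le_mul_of_nonneg_right he hn2.le]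
  choose! W hW1 hW2 hW3 using hper
  -- build an injection from sigma
  have hcount : ∑ x ∈ X, ∑ z ∈ W x, (nb G z ∩ Ysup G S x).card ≤ (Hset G S Z).card := by
    have : ∑ x ∈ X, ∑ z ∈ W x, (nb G z ∩ Ysup G S x).card =
      (X.sigma (fun x => (W x).sigma (fun z => nb G z ∩ Ysup G S x))).card := by
      simp [card_sigma]
    rw [this]
    apply card_le_card_of_injOn (fun a => (a.1, a.2.2, a.2.1))
    · rintro ⟨x, z, y⟩ ha
      simp only [coe_sigma, Set.mem_sigma_iff, mem_coe, mem_inter] at ha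
      obtain ⟨hx, hz, hzy, hy⟩ := ha
      have hz' := hW1 x hx hz
      rw [mem_inter, mem_nb] at hz'
      rw [Ysup, mem_filter, mem_nb] at hy
      rw [mem_nb] at hzy
      simp only [Hset, tri, coe_filter, mem_filter, mem_univ, true_and, Set.mem_ofPred_eq]
      exact ⟨⟨hy.1, hz'.1, hzy.symm⟩, hz'.2, hy.2⟩
    · rintro ⟨x, z, y⟩ _ ⟨x', z', y'⟩ _ hh
      simp only [Prod.mk.injEq] at hh
      obtain ⟨rfl, rfl, rfl⟩ := hh
      rfl
  have hcount' : ∑ x ∈ X, ∑ z ∈ W x, ((nb G z ∩ Ysup G S x).card : ℝ) ≤ (Hset G S Z).card := by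
    exact_mod_cast hcount
  refine le_trans ?_ hcount'
  have hn2 : 0 < n * p ^ 2 := mul_pos h.n0 (by positivity)
  have hg := h.g0
  calc g / 1600 * (n ^ 3 * p ^ 3) = (n / 10) * ((p * n / 160) * (g * (n * p ^ 2))) := by ring
    _ ≤ X.card * ((p * n / 160) * (g * (n * p ^ 2))) := by gcongr
    _ = ∑ x ∈ X, ((p * n / 160) * (g * (n * p ^ 2))) := by simp
    _ ≤ _ := by
      apply sum_le_sum
      intro x hx
      calc _ ≤ ((W x).card : ℝ) * (g * (n * p ^ 2)) := by have := hW2 x hx; gcongr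
        _ = ∑ z ∈ W x, (g * (n * p ^ 2)) := by simp
        _ ≤ _ := sum_le_sum (fun z hz => hW3 x hx z hz)

end Setup
end BLS

namespace BLS
set_option linter.unusedSectionVars false
open Finset
open scoped Classical

/-- greedy derandomised selection -/
lemma select {V α : Type*} (T : Finset α) (vs : α → Finset V) (hvs : ∀ t ∈ T, (vs t).card ≤ 3)
    (hne : ∀ t ∈ T, (vs t).Nonempty)
    (tests : Finset (Finset α)) (η : ℝ) (hη : η ≤ 1) (m : ℕ)
    (hT : ∀ W : Finset V, W.card ≤ 3 * m → (T.filter (fun t => Disjoint (vs t) W)).Nonempty)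
    (hH : ∀ W : Finset V, W.card ≤ 3 * m → ∀ H ∈ tests,
      η * T.card ≤ (((T.filter (fun t => Disjoint (vs t) W)).filter (fun t => t ∈ H)).card : ℝ)) :
    ∀ k ≤ m, ∃ S ⊆ T, S.card = k ∧ (∀ t ∈ S, ∀ t' ∈ S, t ≠ t' → Disjoint (vs t) (vs t')) ∧
      ∑ H ∈ tests, (1 / 2 : ℝ) ^ (S.filter (fun t => t ∈ H)).card ≤ tests.card * (1 - η / 2) ^ k := by
  intro k
  induction k with
  | zero =>
    intro _
    refine ⟨∅, empty_subset _, rfl, by simp, by simp⟩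
  | succ k ih =>
    intro hk
    obtain ⟨S, hST, hSc, hSd, hSs⟩ := ih (by omega)
    set W := S.biUnion vs with hW
    have hWc : W.card ≤ 3 * m := by
      have : W.card ≤ S.card * 3 := card_biUnion_le_card_mul _ _ _ (fun t ht => hvs t (hST ht))
      omega
    set A := T.filter (fun t => Disjoint (vs t) W) with hA
    have hAne := hT W hWc
    have hAc : (A.card : ℝ) ≤ T.card := by exact_mod_cast card_le_card (filter_subset _ _)
    have hnot : ∀ t ∈ A, t ∉ S := by
      intro t ht hS
      rw [hA, mem_filter] at ht
      obtain ⟨v, hv⟩ := hne t ht.1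
      exact (disjoint_left.1 ht.2 hv) (mem_biUnion.2 ⟨t, hS, hv⟩)
    set F : α → ℝ := fun t => ∑ H ∈ tests, (1 / 2 : ℝ) ^ ((insert t S).filter (fun t => t ∈ H)).card
    set Sg := ∑ H ∈ tests, (1 / 2 : ℝ) ^ (S.filter (fun t => t ∈ H)).card with hSg
    have hsum : ∑ t ∈ A, F t ≤ ∑ t ∈ A, ((1 - η / 2) * Sg) := by
      rw [sum_comm, sum_const, nsmul_eq_mul, hSg, mul_sum, mul_sum]
      apply sum_le_sum
      intro H hHm
      have h1 : ∀ t ∈ A, (1 / 2 : ℝ) ^ ((insert t S).filter (fun t => t ∈ H)).card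
          = (1 / 2 : ℝ) ^ (S.filter (fun t => t ∈ H)).card * (1 - (1/2) * (if t ∈ H then (1:ℝ) else 0)) := by
        intro t ht
        rw [filter_insert]
        by_cases htH : t ∈ H
        · rw [if_pos htH, card_insert_of_notMem, pow_succ]
          · simp only [htH, if_true]; ring
          · intro hc; exact hnot t ht (mem_filter.1 hc).1
        · simp [htH]
      rw [sum_congr rfl h1, ← mul_sum, sum_sub_distrib, ← mul_sum, sum_boole]
      have h2 := hH W hWc H hHm
      simp only [sum_const, nsmul_eq_mul, mul_one]
      rw [← hA] at h2
      have h3 : (0:ℝ) ≤ (1 / 2 : ℝ) ^ (S.filter (fun t => t ∈ H)).card := by positivity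
      have h4 : η * A.card ≤ ((A.filter (fun t => t ∈ H)).card : ℝ) := by
        by_cases h0 : 0 ≤ η
        · nlinarith
        · have : η * A.card ≤ 0 := mul_nonpos_of_nonpos_of_nonneg (by linarith) (by positivity)
          have : (0:ℝ) ≤ ((A.filter (fun t => t ∈ H)).card : ℝ) := by positivity
          linarith
      nlinarith [mul_le_mul_of_nonneg_left h4 h3]
    obtain ⟨t, htA, ht⟩ := exists_le_of_sum_le hAne hsum
    refine ⟨insert t S, ?_, ?_, ?_, ?_⟩
    · intro x hx
      rcases mem_insert.1 hx with rfl | hx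
      · exact (mem_filter.1 htA).1
      · exact hST hx
    · rw [card_insert_of_notMem (hnot t htA), hSc]
    · have hd : ∀ t' ∈ S, Disjoint (vs t) (vs t') := by
        intro t' ht'
        exact (mem_filter.1 htA).2.mono_right (subset_biUnion_of_mem vs ht')
      intro a ha b hb hab
      rcases mem_insert.1 ha with h1 | h1 <;> rcases mem_insert.1 hb with h2 | h2
      · exact absurd (h1.trans h2.symm) hab
      · rw [h1]; exact hd b h2
      · rw [h2]; exact (hd a h1).symm
      · exact hSd a h1 b h2 hab
    · refine ht.trans ?_
      rw [pow_succ]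
      have : (0:ℝ) ≤ 1 - η / 2 := by linarith
      nlinarith [mul_le_mul_of_nonneg_left hSs this]

lemma select' {V α : Type*} (T : Finset α) (vs : α → Finset V) (hvs : ∀ t ∈ T, (vs t).card ≤ 3)
    (hne : ∀ t ∈ T, (vs t).Nonempty)
    (tests : Finset (Finset α)) (η : ℝ) (hη : η ≤ 1) (m : ℕ)
    (hT : ∀ W : Finset V, W.card ≤ 3 * m → (T.filter (fun t => Disjoint (vs t) W)).Nonempty)
    (hH : ∀ W : Finset V, W.card ≤ 3 * m → ∀ H ∈ tests,
      η * T.card ≤ (((T.filter (fun t => Disjoint (vs t) W)).filter (fun t => t ∈ H)).card : ℝ))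
    (htests : (tests.card : ℝ) ≤ Real.exp (η * m / 4)) :
    ∃ S ⊆ T, S.card = m ∧ (∀ t ∈ S, ∀ t' ∈ S, t ≠ t' → Disjoint (vs t) (vs t')) ∧
      ∀ H ∈ tests, η * m / 4 ≤ ((S.filter (fun t => t ∈ H)).card : ℝ) := by
  obtain ⟨S, h1, h2, h3, h4⟩ := select T vs hvs hne tests η hη m hT hH m le_rfl
  refine ⟨S, h1, h2, h3, ?_⟩
  intro H hHm
  have h5 : (1 / 2 : ℝ) ^ (S.filter (fun t => t ∈ H)).card ≤
      ∑ H ∈ tests, (1 / 2 : ℝ) ^ (S.filter (fun t => t ∈ H)).card :=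
    single_le_sum (f := fun H => (1 / 2 : ℝ) ^ (S.filter (fun t => t ∈ H)).card)
      (fun i _ => by positivity) hHm
  set k := (S.filter (fun t => t ∈ H)).card
  have h6 : (1 - η / 2) ^ m ≤ Real.exp (- (η * m / 2)) := by
    calc (1 - η / 2) ^ m ≤ (Real.exp (-(η/2))) ^ m := by
          gcongr
          · linarith
          · have := Real.add_one_le_exp (-(η/2)); linarith
      _ = _ := by rw [← Real.exp_nat_mul]; congr 1; ring
  have h7 : Real.exp (-(k:ℝ)) ≤ (1/2 : ℝ) ^ k := by
    have : Real.exp (-1) ≤ 1/2 := by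
      rw [Real.exp_neg, one_div]
      have := Real.add_one_le_exp (1:ℝ)
      gcongr; linarith
    calc Real.exp (-(k:ℝ)) = (Real.exp (-1)) ^ k := by rw [← Real.exp_nat_mul]; congr 1; ring
      _ ≤ _ := by gcongr
  have h8 : Real.exp (-(k:ℝ)) ≤ Real.exp (η * m / 4) * Real.exp (- (η * m / 2)) := by
    calc _ ≤ (tests.card : ℝ) * (1 - η / 2) ^ m := by linarith
      _ ≤ _ := by
        gcongr
        have : (0:ℝ) ≤ 1 - η / 2 := by linarith
        positivity
  rw [← Real.exp_add, Real.exp_le_exp] at h8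
  linarith

variable {V : Type*} [Fintype V]

/-- vertex set of a triple -/
noncomputable def vs (t : V × V × V) : Finset V := {t.1, t.2.1, t.2.2}

lemma mem_vs {t : V × V × V} {v : V} : v ∈ vs t ↔ v = t.1 ∨ v = t.2.1 ∨ v = t.2.2 := by
  simp [vs]

lemma vs_card_le (t : V × V × V) : (vs t).card ≤ 3 := card_le_three

lemma vs_ne (t : V × V × V) : (vs t).Nonempty := ⟨t.1, by simp [vs]⟩

lemma mem_tri {G : SimpleGraph V} {t : V × V × V} :
    t ∈ tri G ↔ G.Adj t.1 t.2.1 ∧ G.Adj t.1 t.2.2 ∧ G.Adj t.2.1 t.2.2 := by simp [tri]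

lemma vs_card {G : SimpleGraph V} {t : V × V × V} (ht : t ∈ tri G) : (vs t).card = 3 := by
  rw [mem_tri] at ht
  exact card_eq_three.2 ⟨_, _, _, ht.1.ne, ht.2.1.ne, ht.2.2.ne, rfl⟩

/-- packings of vertex-disjoint triangles -/
def IsPack (G : SimpleGraph V) (P : Finset (V × V × V)) : Prop :=
  P ⊆ tri G ∧ ∀ t ∈ P, ∀ t' ∈ P, t ≠ t' → Disjoint (vs t) (vs t')

noncomputable def cover (P : Finset (V × V × V)) : Finset V := P.biUnion vs

lemma cover_card {G : SimpleGraph V} {P : Finset (V × V × V)} (hP : IsPack G P) :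
    (cover P).card = 3 * P.card := by
  rw [cover, card_biUnion (fun a ha b hb hab => hP.2 a ha b hb hab),
    sum_congr rfl (fun t ht => vs_card (hP.1 ht))]
  simp [mul_comm]

lemma pack_insert {G : SimpleGraph V} {P : Finset (V × V × V)} (hP : IsPack G P)
    {t : V × V × V} (ht : t ∈ tri G) (hd : Disjoint (vs t) (cover P)) :
    IsPack G (insert t P) ∧ (insert t P).card = P.card + 1 ∧ cover (insert t P) = vs t ∪ cover P := by
  have hd' : ∀ t' ∈ P, Disjoint (vs t) (vs t') := fun t' ht' =>
    hd.mono_right (subset_biUnion_of_mem vs ht')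
  refine ⟨⟨?_, ?_⟩, ?_, ?_⟩
  · exact insert_subset ht hP.1
  · intro a ha b hb hab
    rcases mem_insert.1 ha with h1 | h1 <;> rcases mem_insert.1 hb with h2 | h2
    · exact absurd (h1.trans h2.symm) hab
    · rw [h1]; exact hd' b h2
    · rw [h2]; exact (hd' a h1).symm
    · exact hP.2 a h1 b h2 hab
  · apply card_insert_of_notMem
    intro h
    have := hd' t h
    rw [disjoint_self_iff_empty] at this
    exact (vs_ne t).ne_empty this
  · simp [cover, biUnion_insert]

lemma pack_mono {G : SimpleGraph V} {P Q : Finset (V × V × V)} (hP : IsPack G P) (h : Q ⊆ P) :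
    IsPack G Q := ⟨h.trans hP.1, fun a ha b hb => hP.2 a (h ha) b (h hb)⟩

lemma pack_union {G : SimpleGraph V} {P Q : Finset (V × V × V)} (hP : IsPack G P) (hQ : IsPack G Q)
    (hd : Disjoint (cover P) (cover Q)) : IsPack G (P ∪ Q) ∧ cover (P ∪ Q) = cover P ∪ cover Q := by
  have key : ∀ a ∈ P, ∀ b ∈ Q, Disjoint (vs a) (vs b) := fun a ha b hb =>
    hd.mono (subset_biUnion_of_mem vs ha) (subset_biUnion_of_mem vs hb)
  refine ⟨⟨union_subset hP.1 hQ.1, ?_⟩, ?_⟩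
  · intro a ha b hb hab
    rcases mem_union.1 ha with ha | ha <;> rcases mem_union.1 hb with hb | hb
    · exact hP.2 a ha b hb hab
    · exact key a ha b hb
    · exact (key b hb a ha).symm
    · exact hQ.2 a ha b hb hab
  · simp [cover, union_biUnion]

/-- the absorbing property -/
def Absorbs (G : SimpleGraph V) (T0 : Finset (V × V × V)) (s : ℕ) (r : ℝ) : Prop :=
  ∀ T' ⊆ T0, ((T0 \ T').card : ℝ) ≤ r → ∀ S1 S2 S3 : Finset V, S1.card = s → S2.card = s → S3.card = s →
    ∃ t ∈ T', ∃ t' ∈ T', t ≠ t' ∧ ∃ u1 ∈ S1, ∃ u2 ∈ S2, ∃ u3 ∈ S3,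
      G.Adj u1 t.1 ∧ G.Adj u1 t.2.1 ∧ G.Adj u2 t'.1 ∧ G.Adj u2 t'.2.1 ∧
      G.Adj u3 t.2.2 ∧ G.Adj u3 t'.2.2 ∧ G.Adj t.2.2 t'.2.2

lemma absorb_step {G : SimpleGraph V} {T0 P : Finset (V × V × V)} {s : ℕ} {r : ℝ} (hA : Absorbs G T0 s r)
    (hP : IsPack G P) (hr : ((T0 \ P).card : ℝ) ≤ r) (hs : 3 * s ≤ (univ \ cover P).card) :
    ∃ Q, IsPack G Q ∧ Q.card = P.card + 1 ∧ (T0 \ Q).card ≤ (T0 \ P).card + 2 := by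
  obtain ⟨S1, hS1, c1⟩ := exists_subset_card_eq (s := univ \ cover P) (n := s) (by omega)
  obtain ⟨S2, hS2, c2⟩ := exists_subset_card_eq (s := (univ \ cover P) \ S1) (n := s) (by
    have := le_card_sdiff S1 (univ \ cover P); omega)
  obtain ⟨S3, hS3, c3⟩ := exists_subset_card_eq (s := ((univ \ cover P) \ S1) \ S2) (n := s) (by
    have := le_card_sdiff S1 (univ \ cover P)
    have := le_card_sdiff S2 ((univ \ cover P) \ S1); omega)
  obtain ⟨t, ht, t', ht', hne, u1, hu1, u2, hu2, u3, hu3, e1, e2, e3, e4, e5, e6, e7⟩ :=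
    hA (T0 ∩ P) inter_subset_left (by rwa [sdiff_inter_self_left]) S1 S2 S3 c1 c2 c3
  have htP := (mem_inter.1 ht).2
  have htP' := (mem_inter.1 ht').2
  have h1 : u1 ∉ cover P := by have := hS1 hu1; simpa using this
  have h2 : u2 ∉ cover P ∧ u2 ≠ u1 := by
    have := hS2 hu2; simp only [Finset.mem_sdiff, mem_univ, true_and] at this
    exact ⟨this.1, fun h => this.2 (h ▸ hu1)⟩
  have h3 : u3 ∉ cover P ∧ u3 ≠ u1 ∧ u3 ≠ u2 := by
    have := hS3 hu3; simp only [Finset.mem_sdiff, mem_univ, true_and] at this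
    exact ⟨this.1.1, fun h => this.1.2 (h ▸ hu1), fun h => this.2 (h ▸ hu2)⟩
  set R := (P.erase t).erase t' with hR
  have hRP : R ⊆ P := (erase_subset _ _).trans (erase_subset _ _)
  have hRp : IsPack G R := pack_mono hP hRP
  have hcov : ∀ v ∈ cover R, v ∈ cover P := fun v hv => biUnion_subset_biUnion_of_subset_left vs hRP hv
  have hnt : ∀ v ∈ vs t, v ∉ cover R := by
    intro v hv hc
    obtain ⟨a, ha, hva⟩ := mem_biUnion.1 hc
    have : a ≠ t := by rintro rfl; simp [hR] at ha
    exact disjoint_left.1 (hP.2 a (hRP ha) t htP this) hva hv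
  have hnt' : ∀ v ∈ vs t', v ∉ cover R := by
    intro v hv hc
    obtain ⟨a, ha, hva⟩ := mem_biUnion.1 hc
    have : a ≠ t' := by rintro rfl; simp [hR] at ha
    exact disjoint_left.1 (hP.2 a (hRP ha) t' htP' this) hva hv
  have hdd : ∀ v ∈ vs t, ∀ w ∈ vs t', v ≠ w := by
    intro v hv w hw hvw
    subst hvw
    exact disjoint_left.1 (hP.2 t htP t' htP' hne) hv hw
  have hct : ∀ v ∈ vs t, v ∈ cover P := fun v hv => mem_biUnion.2 ⟨t, htP, hv⟩
  have hct' : ∀ v ∈ vs t', v ∈ cover P := fun v hv => mem_biUnion.2 ⟨t', htP', hv⟩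
  have htri := mem_tri.1 (hP.1 htP)
  have htri' := mem_tri.1 (hP.1 htP')
  obtain ⟨x, y, z⟩ := t
  obtain ⟨x', y', z'⟩ := t'
  simp only [mem_vs, forall_eq_or_imp, forall_eq] at hnt hnt' hdd hct hct'
  simp only at htri htri' e1 e2 e3 e4 e5 e6 e7
  have ne_of : ∀ {u v : V}, u ∉ cover P → v ∈ cover P → u ≠ v := by
    intro u v hu hv h; exact hu (h ▸ hv)
  obtain ⟨p1, k1, cv1⟩ := pack_insert hRp (t := (u1, x, y)) (mem_tri.2 ⟨e1, e2, htri.1⟩) (by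
    rw [disjoint_left]; intro v hv
    simp only [mem_vs] at hv
    rcases hv with rfl | rfl | rfl
    · exact fun h => h1 (hcov _ h)
    · exact hnt.1
    · exact hnt.2.1)
  obtain ⟨p2, k2, cv2⟩ := pack_insert p1 (t := (u2, x', y')) (mem_tri.2 ⟨e3, e4, htri'.1⟩) (by
    rw [disjoint_left]; intro v hv
    rw [cv1]
    simp only [mem_vs] at hv
    simp only [mem_union, mem_vs, not_or]
    rcases hv with rfl | rfl | rfl
    · exact ⟨⟨h2.2, ne_of h2.1 hct.1, ne_of h2.1 hct.2.1⟩, fun h => h2.1 (hcov _ h)⟩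
    · exact ⟨⟨(ne_of h1 hct'.1).symm, hdd.1.1.symm, hdd.2.1.1.symm⟩, hnt'.1⟩
    · exact ⟨⟨(ne_of h1 hct'.2.1).symm, hdd.1.2.1.symm, hdd.2.1.2.1.symm⟩, hnt'.2.1⟩)
  obtain ⟨p3, k3, cv3⟩ := pack_insert p2 (t := (u3, z, z')) (mem_tri.2 ⟨e5, e6, e7⟩) (by
    rw [disjoint_left]; intro v hv
    rw [cv2, cv1]
    simp only [mem_vs] at hv
    simp only [mem_union, mem_vs, not_or]
    rcases hv with rfl | rfl | rfl
    · exact ⟨⟨h3.2.2, ne_of h3.1 hct'.1, ne_of h3.1 hct'.2.1⟩, ⟨h3.2.1, ne_of h3.1 hct.1, ne_of h3.1 hct.2.1⟩,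
        fun h => h3.1 (hcov _ h)⟩
    · exact ⟨⟨(ne_of h2.1 hct.2.2).symm, hdd.2.2.1, hdd.2.2.2.1⟩,
        ⟨(ne_of h1 hct.2.2).symm, htri.2.1.ne.symm, htri.2.2.ne.symm⟩, hnt.2.2⟩
    · exact ⟨⟨(ne_of h2.1 hct'.2.2).symm, htri'.2.1.ne.symm, htri'.2.2.ne.symm⟩,
        ⟨(ne_of h1 hct'.2.2).symm, hdd.1.2.2.symm, hdd.2.1.2.2.symm⟩, hnt'.2.2⟩)
  refine ⟨_, p3, ?_, ?_⟩
  · rw [k3, k2, k1, hR, card_erase_of_mem (mem_erase.2 ⟨hne.symm, htP'⟩), card_erase_of_mem htP]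
    have : 2 ≤ P.card := by
      have : ({(x, y, z), (x', y', z')} : Finset (V × V × V)) ⊆ P := by
        intro a ha; simp only [mem_insert, mem_singleton] at ha
        rcases ha with rfl | rfl <;> assumption
      have := card_le_card this
      rwa [card_pair hne] at this
    omega
  · have hsub : T0 \ insert (u3, z, z') (insert (u2, x', y') (insert (u1, x, y) R)) ⊆
        (T0 \ P) ∪ {(x, y, z), (x', y', z')} := by
      intro a ha
      rw [Finset.mem_sdiff] at ha
      have haR : a ∉ R := fun h => ha.2 (by simp [h])
      simp only [hR, mem_erase, not_and] at haR
      simp only [mem_union, Finset.mem_sdiff, mem_insert, mem_singleton]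
      by_cases h1 : a = (x', y', z')
      · tauto
      · by_cases h2 : a = (x, y, z)
        · tauto
        · exact Or.inl ⟨ha.1, haR h1 h2⟩
    have := card_le_card hsub
    have := card_union_le (T0 \ P) {(x, y, z), (x', y', z')}
    have := card_le_two (a := (x, y, z)) (b := (x', y', z'))
    omega

lemma absorb_all {G : SimpleGraph V} {T0 P0 : Finset (V × V × V)} {s : ℕ} {r : ℝ} (hA : Absorbs G T0 s r)
    (hP0 : IsPack G P0) (hT : T0 ⊆ P0) (hr : ((univ \ cover P0).card : ℝ) ≤ r) :
    ∃ P, IsPack G P ∧ (univ \ cover P).card < 3 * s := by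
  set F := (univ : Finset (Finset (V × V × V))).filter
    (fun P => IsPack G P ∧ (T0 \ P).card + 2 * P0.card ≤ 2 * P.card) with hF
  have hne : F.Nonempty := ⟨P0, by
    rw [hF, mem_filter]
    refine ⟨mem_univ _, hP0, ?_⟩
    rw [sdiff_eq_empty_iff_subset.2 hT]; simp⟩
  obtain ⟨P, hPF, hmax⟩ := exists_max_image F card hne
  rw [hF, mem_filter] at hPF
  obtain ⟨_, hP, hc⟩ := hPF
  refine ⟨P, hP, ?_⟩
  by_contra hcon
  push Not at hcon
  have c1 := cover_card hP0
  have c2 := cover_card hP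
  have c3 : (univ \ cover P0).card + (cover P0).card = Fintype.card V := by
    rw [card_sdiff_add_card_eq_card (subset_univ _), card_univ]
  have c4 : (cover P).card ≤ Fintype.card V := card_le_univ _
  have c5 : (T0 \ P).card ≤ (univ \ cover P0).card := by omega
  obtain ⟨Q, hQ, q1, q2⟩ := absorb_step hA hP (le_trans (by exact_mod_cast c5) hr) hcon
  have := hmax Q (by rw [hF, mem_filter]; exact ⟨mem_univ _, hQ, by omega⟩)
  omega

end BLS

namespace BLS
set_option linter.unusedSectionVars false
open Finset
open scoped Classical

variable {V : Type*} [Fintype V]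
variable {Γ G : SimpleGraph V} {n p ε K g : ℝ}

namespace Setup

lemma touch1 (h : Setup Γ G n p ε K g) (W : Finset V) :
    (((tri G).filter (fun t => t.1 ∈ W)).card : ℝ) ≤ 16 * W.card * (n ^ 2 * p ^ 3) := by
  have h1 : ((tri G).filter (fun t => t.1 ∈ W)).card ≤
      (W.sigma (fun x => (nb Γ x).sigma (fun y => nb Γ x ∩ nb Γ y))).card := by
    apply card_le_card_of_injOn (fun t => ⟨t.1, t.2.1, t.2.2⟩)
    · rintro ⟨x, y, z⟩ ht
      simp only [coe_filter, Set.mem_ofPred_eq, mem_tri] at ht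
      simp only [coe_sigma, Set.mem_sigma_iff, mem_coe, mem_inter, mem_nb]
      exact ⟨ht.2, h.sub ht.1.1, h.sub ht.1.2.1, h.sub ht.1.2.2⟩
    · rintro ⟨x, y, z⟩ _ ⟨x', y', z'⟩ _ hh
      simp only [Sigma.mk.injEq, heq_eq_eq] at hh
      obtain ⟨rfl, rfl, rfl⟩ := hh
      rfl
  have hn2 : 0 < n * p ^ 2 := mul_pos h.n0 (pow_pos h.p0 2)
  have h2 : ((W.sigma (fun x => (nb Γ x).sigma (fun y => nb Γ x ∩ nb Γ y))).card : ℝ) ≤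
      16 * W.card * (n ^ 2 * p ^ 3) := by
    rw [card_sigma]
    push_cast
    calc _ ≤ ∑ x ∈ W, (2 * (n * p)) * (8 * (n * p ^ 2)) := by
          apply sum_le_sum
          intro x _
          rw [card_sigma]
          push_cast
          calc _ ≤ ∑ y ∈ nb Γ x, (8 * (n * p ^ 2)) := by
                apply sum_le_sum
                intro y hy
                exact h.qr.codeg x y (mem_nb.1 hy).ne
            _ = (nb Γ x).card * (8 * (n * p ^ 2)) := by simp
            _ ≤ _ := by have := h.degle x; gcongr
      _ = _ := by simp; ring
  exact le_trans (by exact_mod_cast h1) h2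

lemma touch (h : Setup Γ G n p ε K g) (W : Finset V) :
    (((tri G).filter (fun t => ¬ Disjoint (vs t) W)).card : ℝ) ≤ 48 * W.card * (n ^ 2 * p ^ 3) := by
  have h1 := h.touch1 W
  have h2 : ((tri G).filter (fun t => t.2.1 ∈ W)).card ≤ ((tri G).filter (fun t => t.1 ∈ W)).card := by
    apply card_le_card_of_injOn (fun t => (t.2.1, t.1, t.2.2))
    · rintro ⟨x, y, z⟩ ht
      simp only [coe_filter, Set.mem_ofPred_eq, mem_tri] at ht ⊢
      exact ⟨⟨ht.1.1.symm, ht.1.2.2, ht.1.2.1⟩, ht.2⟩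
    · rintro ⟨x, y, z⟩ _ ⟨x', y', z'⟩ _ hh
      simp only [Prod.mk.injEq] at hh
      obtain ⟨rfl, rfl, rfl⟩ := hh
      rfl
  have h3 : ((tri G).filter (fun t => t.2.2 ∈ W)).card ≤ ((tri G).filter (fun t => t.1 ∈ W)).card := by
    apply card_le_card_of_injOn (fun t => (t.2.2, t.1, t.2.1))
    · rintro ⟨x, y, z⟩ ht
      simp only [coe_filter, Set.mem_ofPred_eq, mem_tri] at ht ⊢
      exact ⟨⟨ht.1.2.1.symm, ht.1.2.2.symm, ht.1.1⟩, ht.2⟩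
    · rintro ⟨x, y, z⟩ _ ⟨x', y', z'⟩ _ hh
      simp only [Prod.mk.injEq] at hh
      obtain ⟨rfl, rfl, rfl⟩ := hh
      rfl
  have h4 : ((tri G).filter (fun t => ¬ Disjoint (vs t) W)) ⊆ ((tri G).filter (fun t => t.1 ∈ W)) ∪
      ((tri G).filter (fun t => t.2.1 ∈ W)) ∪ ((tri G).filter (fun t => t.2.2 ∈ W)) := by
    intro t ht
    rw [mem_filter, not_disjoint_iff] at ht
    obtain ⟨ht, v, hv, hvW⟩ := ht
    rw [mem_vs] at hv
    simp only [mem_union, mem_filter]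
    rcases hv with rfl | rfl | rfl <;> tauto
  have h5 := card_le_card h4
  have h6 := card_union_le (((tri G).filter (fun t => t.1 ∈ W)) ∪
      ((tri G).filter (fun t => t.2.1 ∈ W))) ((tri G).filter (fun t => t.2.2 ∈ W))
  have h7 := card_union_le ((tri G).filter (fun t => t.1 ∈ W)) ((tri G).filter (fun t => t.2.1 ∈ W))
  have h8 : (((tri G).filter (fun t => ¬ Disjoint (vs t) W)).card : ℝ) ≤
    3 * ((tri G).filter (fun t => t.1 ∈ W)).card := by exact_mod_cast (by omega)
  linarith

lemma tri_card (h : Setup Γ G n p ε K g) : ((tri G).card : ℝ) ≤ 16 * (n ^ 3 * p ^ 3) := by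
  have := h.touch1 univ
  simp only [mem_univ, filter_true, card_univ, h.card] at this
  linarith

/-- well supported vertices -/
noncomputable def Lset (G : SimpleGraph V) (n p : ℝ) (S : Finset V) : Finset V :=
  univ.filter (fun x => n * p / 3 ≤ ((Ysup G S x).card : ℝ))

lemma Lset_card (h : Setup Γ G n p ε K g) (S : Finset V) (hS : 200 * K ≤ p ^ 2 * S.card)
    (hS' : 2 * K / ε ≤ p ^ 2 * S.card) : n / 4 ≤ ((Lset G n p S).card : ℝ) := by
  have h1 := h.goodX_card S hS'
  have h2 : goodX Γ G n p ε S ⊆ Lset G n p S := by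
    intro x hx
    have := h.support S hS hx
    rw [Lset, mem_filter]
    refine ⟨mem_univ _, ?_⟩
    have := h.np0; have := h.g0
    nlinarith [mul_pos h.np0 h.g0]
  have h3 : ((goodX Γ G n p ε S).card : ℝ) ≤ (Lset G n p S).card := by exact_mod_cast card_le_card h2
  have := h.n0
  linarith

lemma Zset_card (h : Setup Γ G n p ε K g) (S P : Finset V) (hP : P ⊆ Lset G n p S)
    (hq : K / p < P.card) : n / 4 ≤ ((P.biUnion (Ysup G S)).card : ℝ) := by
  set Z := P.biUnion (Ysup G S) with hZ
  have hd := h.qr.disc Z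
  have hlt := lt_of_le_of_lt hd hq
  have : ∃ z ∈ P, z ∉ (univ.filter (fun x => ¬ |((nb Γ x ∩ Z).card : ℝ) - p * Z.card| ≤ ε * (n * p))) := by
    by_contra hc
    apply not_le.2 hlt
    exact_mod_cast card_le_card (fun z hz => by by_contra h'; exact hc ⟨z, hz, h'⟩)
  obtain ⟨z, hzP, hz⟩ := this
  simp only [mem_filter, mem_univ, true_and, not_not] at hz
  have h1 := (abs_le.1 hz).2
  have h2 := hP hzP
  rw [Lset, mem_filter] at h2
  have h3 : ((Ysup G S z).card : ℝ) ≤ (nb Γ z ∩ Z).card := by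
    gcongr
    intro y hy
    rw [mem_inter]
    exact ⟨h.subnb z (mem_filter.1 hy).1, mem_biUnion.2 ⟨z, hzP, hy⟩⟩
  have h4 : ε ≤ 1/60 := by have := h.eg; have := h.g1; linarith
  have h5 := mul_le_mul_of_nonneg_right h4 h.np0.le
  have h6 : p * (n / 4) ≤ p * Z.card := by nlinarith [h2.2, h.np0]
  exact le_of_mul_le_mul_left h6 h.p0

lemma exists_absorber (h : Setup Γ G n p ε K g) (s q m : ℕ) (r : ℝ) (hS : 200 * K ≤ p ^ 2 * s)
    (hS' : 2 * K / ε ≤ p ^ 2 * s) (hbig' : 8 * K / ε ≤ n * p ^ 2) (hq : K / p < q) (hqr : (q : ℝ) ≤ r)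
    (hm : (m : ℝ) ≤ g / 1600 * n / 288) (hr : 2 * r ≤ g / 51200 * m / 4)
    (ht : 2 * n ^ (2 * s + q) ≤ Real.exp (g / 51200 * m / 4)) :
    ∃ T0, IsPack G T0 ∧ T0.card = m ∧ Absorbs G T0 s r := by
  have hp := h.p0
  have hn := h.n0
  have hg := h.g0
  have hc := h.card
  set PS := powersetCard s (univ : Finset V) with hPS
  set I2 := (PS ×ˢ PS ×ˢ (powersetCard q (univ : Finset V))).filter
    (fun i => i.2.2 ⊆ Lset G n p i.2.1) with hI2
  set tests1 := (PS ×ˢ PS).image (fun i => Hset G i.1 (Lset G n p i.2)) with ht1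
  set tests2 := I2.image (fun i => Hset G i.1 (i.2.2.biUnion (Ysup G i.2.1))) with ht2
  have hcardPS : ∀ k : ℕ, (((powersetCard k (univ : Finset V)).card : ℕ) : ℝ) ≤ n ^ k := by
    intro k
    rw [card_powersetCard, ← hc, card_univ]
    exact_mod_cast Nat.choose_le_pow _ _
  have hn1 : 1 ≤ n := by
    rw [← hc] at hn ⊢
    exact_mod_cast hn
  have hcard : ((tests1 ∪ tests2).card : ℝ) ≤ 2 * n ^ (2 * s + q) := by
    have c1 : (tests1.card : ℝ) ≤ n ^ (2 * s + q) := by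
      calc (tests1.card : ℝ) ≤ (PS ×ˢ PS).card := by exact_mod_cast card_image_le
        _ = PS.card * PS.card := by rw [card_product]; push_cast; rfl
        _ ≤ n ^ s * n ^ s := by have := hcardPS s; gcongr
        _ = n ^ (2 * s) := by rw [two_mul, pow_add]
        _ ≤ _ := pow_le_pow_right₀ hn1 (by omega)
    have c2 : (tests2.card : ℝ) ≤ n ^ (2 * s + q) := by
      calc (tests2.card : ℝ) ≤ I2.card := by exact_mod_cast card_image_le
        _ ≤ (PS ×ˢ PS ×ˢ (powersetCard q (univ : Finset V))).card := by exact_mod_cast card_filter_le _ _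
        _ = PS.card * (PS.card * (powersetCard q (univ : Finset V)).card) := by
            rw [card_product, card_product]; push_cast; rfl
        _ ≤ n ^ s * (n ^ s * n ^ q) := by have := hcardPS s; have := hcardPS q; gcongr
        _ = _ := by rw [two_mul, pow_add, pow_add]; ring
    have : ((tests1 ∪ tests2).card : ℝ) ≤ tests1.card + tests2.card := by exact_mod_cast card_union_le _ _
    linarith
  have hsub : ∀ H ∈ tests1 ∪ tests2, ∃ S Z : Finset V, H = Hset G S Z ∧ S.card = s ∧ n / 4 ≤ Z.card := by
    intro H hH
    rcases mem_union.1 hH with hH | hH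
    · obtain ⟨⟨S1, S3⟩, hi, rfl⟩ := mem_image.1 hH
      simp only [mem_product, hPS, mem_powersetCard] at hi
      exact ⟨S1, _, rfl, hi.1.2, h.Lset_card S3 (by rwa [hi.2.2]) (by rwa [hi.2.2])⟩
    · obtain ⟨⟨S2, S3, P⟩, hi, rfl⟩ := mem_image.1 hH
      simp only [hI2, mem_filter, mem_product, hPS, mem_powersetCard] at hi
      exact ⟨S2, _, rfl, hi.1.1.2, h.Zset_card S3 P hi.2 (by rwa [hi.1.2.2.2])⟩
  have hcount : ∀ W : Finset V, W.card ≤ 3 * m → ∀ S Z : Finset V, 200 * K ≤ p ^ 2 * S.card →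
      2 * K / ε ≤ p ^ 2 * S.card → n / 4 ≤ Z.card →
      g / 3200 * (n ^ 3 * p ^ 3) ≤
        ((((tri G).filter (fun t => Disjoint (vs t) W)).filter (fun t => t ∈ Hset G S Z)).card : ℝ) := by
    intro W hW S Z hS1 hS2 hZ
    have r1 := h.reach S Z hS1 hS2 hbig' hZ
    have r2 := h.touch W
    have r3 : Hset G S Z ⊆ (((tri G).filter (fun t => Disjoint (vs t) W)).filter (fun t => t ∈ Hset G S Z)) ∪
        ((tri G).filter (fun t => ¬ Disjoint (vs t) W)) := by
      intro t htH
      have : t ∈ tri G := (mem_filter.1 htH).1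
      simp only [mem_union, mem_filter]
      tauto
    have r4 : ((Hset G S Z).card : ℝ) ≤
        ((((tri G).filter (fun t => Disjoint (vs t) W)).filter (fun t => t ∈ Hset G S Z)).card : ℝ)
         + ((tri G).filter (fun t => ¬ Disjoint (vs t) W)).card := by
      exact_mod_cast (card_le_card r3).trans (card_union_le _ _)
    have r5 : (W.card : ℝ) ≤ 3 * m := by exact_mod_cast hW
    have r6 : 48 * (W.card : ℝ) * (n ^ 2 * p ^ 3) ≤ 48 * (3 * (g / 1600 * n / 288)) * (n ^ 2 * p ^ 3) := by
      gcongr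
      linarith
    have r7 : 48 * (3 * (g / 1600 * n / 288)) * (n ^ 2 * p ^ 3) = g / 3200 * (n ^ 3 * p ^ 3) := by ring
    linarith
  have hpos : 0 < g / 3200 * (n ^ 3 * p ^ 3) := by positivity
  have hS1u : p ^ 2 * s ≤ p ^ 2 * (univ : Finset V).card ∨ n < s := by
    by_cases hsn : n < s
    · exact Or.inr hsn
    · left
      rw [card_univ, hc]
      have := not_lt.1 hsn
      gcongr
  have hu : 200 * K ≤ p ^ 2 * (univ : Finset V).card ∧ 2 * K / ε ≤ p ^ 2 * (univ : Finset V).card := by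
    rw [card_univ, hc]
    have := h.big; have := h.K1
    have e : 8 * K / ε = 4 * (2 * K / ε) := by ring
    have : 0 < 2 * K / ε := by have := h.e0; positivity
    constructor
    · linarith
    · linarith
  obtain ⟨T0, hT1, hT2, hT3, hT4⟩ := select' (tri G) vs (fun t _ => vs_card_le t) (fun t _ => vs_ne t)
    (tests1 ∪ tests2) (g / 51200) (by have := h.g1; linarith) m
    (by
      intro W hW
      have := hcount W hW univ univ hu.1 hu.2 (by rw [card_univ, hc]; linarith)
      have h2 : 0 < (((tri G).filter (fun t => Disjoint (vs t) W)).filter (fun t => t ∈ Hset G univ univ)).card := by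
        have := lt_of_lt_of_le hpos this
        exact_mod_cast this
      obtain ⟨t, ht⟩ := card_pos.1 h2
      exact ⟨t, (mem_filter.1 ht).1⟩)
    (by
      intro W hW H hH
      obtain ⟨S, Z, rfl, hSc, hZ⟩ := hsub H hH
      refine le_trans ?_ (le_trans (hcount W hW S Z (by rwa [hSc]) (by rwa [hSc]) hZ)
        (le_of_eq (by congr!)))
      have := h.tri_card
      have := mul_le_mul_of_nonneg_left this (by positivity : 0 ≤ g / 51200)
      linarith)
    (hcard.trans ht)
  have hT4 : ∀ H ∈ tests1 ∪ tests2, g / 51200 * m / 4 ≤ ((T0.filter (fun t => t ∈ H)).card : ℝ) := by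
    intro H hH
    convert hT4 H hH
  refine ⟨T0, ⟨hT1, hT3⟩, hT2, ?_⟩
  intro T' hT' hrem S1 S2 S3 c1 c2 c3
  have hKp0 : 0 < K / p := div_pos (by linarith [h.K1]) hp
  have hhit : ∀ H ∈ tests1 ∪ tests2, r ≤ ((T'.filter (fun t => t ∈ H)).card : ℝ) := by
    intro H hH
    have := hT4 H hH
    have h2 : T0.filter (fun t => t ∈ H) ⊆ (T'.filter (fun t => t ∈ H)) ∪ (T0 \ T') := by
      intro t ht
      simp only [mem_filter, mem_union, Finset.mem_sdiff] at *
      tauto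
    have h3 : ((T0.filter (fun t => t ∈ H)).card : ℝ) ≤ (T'.filter (fun t => t ∈ H)).card + (T0 \ T').card := by
      exact_mod_cast (card_le_card h2).trans (card_union_le _ _)
    linarith
  have hm1 : Hset G S1 (Lset G n p S3) ∈ tests1 ∪ tests2 := by
    apply mem_union_left
    refine mem_image.2 ⟨(S1, S3), ?_, rfl⟩
    simp [hPS, mem_powersetCard, c1, c3]
  have hh1 := hqr.trans (hhit _ hm1)
  have hh1' : q ≤ (T'.filter (fun t => t ∈ Hset G S1 (Lset G n p S3))).card := by exact_mod_cast hh1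
  obtain ⟨A, hA, hAc⟩ := exists_subset_card_eq hh1'
  have hinj : Set.InjOn (fun t : V × V × V => t.2.2) (A : Set (V × V × V)) := by
    intro a ha b hb hab
    by_contra hne
    have ha' := hT' (mem_filter.1 (hA ha)).1
    have hb' := hT' (mem_filter.1 (hA hb)).1
    have hd := hT3 a ha' b hb' hne
    exact disjoint_left.1 hd (mem_vs.2 (Or.inr (Or.inr rfl)) : a.2.2 ∈ vs a)
      (mem_vs.2 (Or.inr (Or.inr hab)))
  set P := A.image (fun t => t.2.2) with hP
  have hPc : P.card = q := by rw [hP, card_image_of_injOn hinj, hAc]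
  have hPL : P ⊆ Lset G n p S3 := by
    intro z hz
    obtain ⟨t, ht, rfl⟩ := mem_image.1 hz
    have := (mem_filter.1 (hA ht)).2
    exact (mem_filter.1 this).2.1
  have hm2 : Hset G S2 (P.biUnion (Ysup G S3)) ∈ tests1 ∪ tests2 := by
    apply mem_union_right
    refine mem_image.2 ⟨(S2, S3, P), ?_, rfl⟩
    simp [hI2, hPS, mem_powersetCard, c2, c3, hPc, hPL]
  have hh2 := hhit _ hm2
  have hh2' : 0 < (T'.filter (fun t => t ∈ Hset G S2 (P.biUnion (Ysup G S3)))).card := by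
    have : (0:ℝ) < (T'.filter (fun t => t ∈ Hset G S2 (P.biUnion (Ysup G S3)))).card := by linarith
    exact_mod_cast this
  obtain ⟨t', ht'⟩ := card_pos.1 hh2'
  rw [mem_filter] at ht'
  have ht'2 := (mem_filter.1 ht'.2).2
  obtain ⟨hz', u2, hu2, e3, e4⟩ := ht'2
  obtain ⟨z, hzP, hzY⟩ := mem_biUnion.1 hz'
  obtain ⟨t, htA, rfl⟩ := mem_image.1 hzP
  have htm := mem_filter.1 (hA htA)
  obtain ⟨_, u1, hu1, e1, e2⟩ := (mem_filter.1 htm.2).2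
  rw [Ysup, mem_filter, mem_nb] at hzY
  obtain ⟨hadj, u3, hu3, e5, e6⟩ := hzY
  refine ⟨t, htm.1, t', ht'.1, ?_, u1, hu1, u2, hu2, u3, hu3, e1, e2, e3, e4, e5, e6, hadj⟩
  rintro rfl
  exact hadj.ne rfl

end Setup
end BLS

namespace BLS
set_option linter.unusedSectionVars false
open Finset
open scoped Classical

variable {V : Type*} [Fintype V]
variable {Γ G : SimpleGraph V} {n p ε K g : ℝ}

lemma quant (U : Finset V) (f : V → ℝ) (q : ℝ) (hq0 : 0 ≤ q) (hq : q ≤ U.card) (hU : U.Nonempty) :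
    ∃ x ∈ U, q ≤ ((U.filter (fun y => f y ≤ f x)).card : ℝ) ∧
      ((U.filter (fun y => f y < f x)).card : ℝ) ≤ q := by
  set F := U.filter (fun x => q ≤ ((U.filter (fun y => f y ≤ f x)).card : ℝ)) with hF
  have hne : F.Nonempty := by
    obtain ⟨x, hx, hmax⟩ := exists_max_image U f hU
    refine ⟨x, mem_filter.2 ⟨hx, ?_⟩⟩
    rwa [filter_true_of_mem (fun y hy => hmax y hy)]
  obtain ⟨x, hx, hmin⟩ := exists_min_image F f hne
  rw [hF, mem_filter] at hx
  refine ⟨x, hx.1, hx.2, ?_⟩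
  by_cases hE : (U.filter (fun y => f y < f x)).Nonempty
  · obtain ⟨z, hz, hzmax⟩ := exists_max_image _ f hE
    have hz' := mem_filter.1 hz
    have : z ∉ F := fun hzF => absurd (hmin z hzF) (not_le.2 hz'.2)
    rw [hF, mem_filter] at this
    have h2 : ((U.filter (fun y => f y ≤ f z)).card : ℝ) < q := by
      by_contra hc
      exact this ⟨hz'.1, not_lt.1 hc⟩
    refine le_trans ?_ h2.le
    exact_mod_cast card_le_card (fun y hy => mem_filter.2 ⟨(mem_filter.1 hy).1, hzmax y hy⟩)
  · rw [not_nonempty_iff_eq_empty.1 hE]; simpa using hq0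

lemma three_quant (U : Finset V) (f : V → ℝ) (hf : ∀ x, 0 ≤ f x) (δ : ℝ) (hd0 : 0 < δ) (hd : δ ≤ 1 / 6)
    (hU : U.Nonempty) :
    ∃ A B C : Finset V, A ⊆ U ∧ B ⊆ U ∧ C ⊆ U ∧ δ * U.card ≤ A.card ∧ (1 / 3) * (U.card : ℝ) ≤ B.card ∧
      (2 / 3) * (U.card : ℝ) ≤ C.card ∧ ∀ a ∈ A, ∀ b ∈ B, ∀ c ∈ C,
        U.card * (f a + f b + f c) ≤ (3 + 6 * δ) * ∑ x ∈ U, f x := by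
  have hu : (0:ℝ) < U.card := by exact_mod_cast card_pos.2 hU
  obtain ⟨x, hx, hx1, hx2⟩ := quant U f (δ * U.card) (by positivity) (by nlinarith) hU
  obtain ⟨y, hy, hy1, hy2⟩ := quant U f ((1 / 3) * U.card) (by positivity) (by nlinarith) hU
  obtain ⟨z, hz, hz1, hz2⟩ := quant U f ((2 / 3) * U.card) (by positivity) (by nlinarith) hU
  have mono : ∀ x y : V, ((U.filter (fun w => f w < f x)).card : ℝ) < (U.filter (fun w => f w ≤ f y)).card →
      f x ≤ f y := by
    intro x y h
    by_contra hc
    push Not at hc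
    have : ((U.filter (fun w => f w ≤ f y)).card : ℝ) ≤ (U.filter (fun w => f w < f x)).card := by
      exact_mod_cast card_le_card (fun w hw =>
        mem_filter.2 ⟨(mem_filter.1 hw).1, lt_of_le_of_lt (mem_filter.1 hw).2 hc⟩)
    linarith
  have hxy : f x ≤ f y := mono x y (by nlinarith)
  have hyz : f y ≤ f z := mono y z (by nlinarith)
  refine ⟨_, _, _, filter_subset _ _, filter_subset _ _, filter_subset _ _, hx1, hy1, hz1, ?_⟩
  intro a ha b hb c hc
  rw [mem_filter] at ha hb hc
  have key : ∀ w ∈ U, f x * (if f w < f x then (0:ℝ) else 1) + (f y - f x) * (if f w < f y then (0:ℝ) else 1)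
     + (f z - f y) * (if f w < f z then (0:ℝ) else 1) ≤ f w := by
    intro w _
    have := hf w
    have := hf x
    split_ifs <;> linarith
  have hs := sum_le_sum key
  rw [sum_add_distrib, sum_add_distrib, ← mul_sum, ← mul_sum, ← mul_sum] at hs
  have cnt : ∀ x : V, ∑ w ∈ U, (if f w < f x then (0:ℝ) else 1) = U.card - ((U.filter (fun w => f w < f x)).card : ℝ) := by
    intro x
    have h1 : ∀ w ∈ U, (if f w < f x then (0:ℝ) else 1) = 1 - (if f w < f x then (1:ℝ) else 0) := by
      intro w _; split_ifs <;> norm_num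
    rw [sum_congr rfl h1, sum_sub_distrib, sum_boole]; simp
  rw [cnt, cnt, cnt] at hs
  have p1 := hf x
  have m1 := mul_le_mul_of_nonneg_left hx2 p1
  have m2 := mul_le_mul_of_nonneg_left hy2 (by linarith : 0 ≤ f y - f x)
  have m3 := mul_le_mul_of_nonneg_left hz2 (by linarith : 0 ≤ f z - f y)
  set Sg := ∑ x ∈ U, f x
  set u := (U.card : ℝ)
  have main : f x * u * (1/3 - δ) + f y * u / 3 + f z * u / 3 ≤ Sg := by nlinarith
  have q1 : f x * u ≤ f y * u := by gcongr
  have q2 : f x * u ≤ f z * u := by have := hxy.trans hyz; gcongr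
  have q3 : 0 ≤ f x * u := by positivity
  have q4 : f x * u ≤ 2 * Sg := by nlinarith
  have q5 : δ * (f x * u) ≤ δ * (2 * Sg) := by gcongr
  have : u * (f x + f y + f z) ≤ (3 + 6 * δ) * Sg := by nlinarith
  refine le_trans ?_ this
  have := ha.2; have := hb.2; have := hc.2
  gcongr

namespace Setup

lemma inter_split (h : Setup Γ G n p ε K g) (a : V) {U C : Finset V} (hC : C ⊆ U) :
    ((nb G a ∩ U).card : ℝ) ≤ (nb G a ∩ C).card + (nb Γ a ∩ (U \ C)).card := by
  have : nb G a ∩ U ⊆ (nb G a ∩ C) ∪ (nb Γ a ∩ (U \ C)) := by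
    intro x hx
    rw [mem_inter] at hx
    by_cases hxC : x ∈ C
    · exact mem_union_left _ (mem_inter.2 ⟨hx.1, hxC⟩)
    · exact mem_union_right _ (mem_inter.2 ⟨h.subnb a hx.1, Finset.mem_sdiff.2 ⟨hx.2, hxC⟩⟩)
  exact_mod_cast (card_le_card this).trans (card_union_le _ _)

/-- exceptional set for `disc` -/
noncomputable def exc (Γ : SimpleGraph V) (n p ε : ℝ) (Y : Finset V) : Finset V :=
  univ.filter (fun x => ¬ |((nb Γ x ∩ Y).card : ℝ) - p * Y.card| ≤ ε * (n * p))

lemma exc_card (h : Setup Γ G n p ε K g) (Y : Finset V) : ((exc Γ n p ε Y).card : ℝ) ≤ K / p := h.qr.disc Y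

lemma not_exc {Y : Finset V} {x : V} (hx : x ∉ exc Γ n p ε Y) :
    ((nb Γ x ∩ Y).card : ℝ) ≤ p * Y.card + ε * (n * p) := by
  simp only [exc, mem_filter, mem_univ, true_and, not_not] at hx
  linarith [(abs_le.1 hx).2]

/-- `b` is exceptional for `a` -/
def exP (Γ G : SimpleGraph V) (n p ε : ℝ) (U : Finset V) (a b : V) : Prop :=
  a ∈ nb Γ b ∧ ¬ |((nb Γ a ∩ (nb G b ∩ U)).card : ℝ) - p * (nb G b ∩ U).card| ≤ ε * (n * p ^ 2)

set_option maxHeartbeats 1000000 in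
lemma key (h : Setup Γ G n p ε K g) (U Bad A B C : Finset V) (g1 ε0 : ℝ) (hg1 : 0 < g1) (hε0 : 0 < ε0)
    (hU : ε0 * n ≤ U.card) (hεε : ε ≤ ε0 * g1 / 16) (hK : 8 * K / (g1 * ε0) ≤ n * p ^ 2)
    (hBad : ∀ v, v ∉ Bad → (2 / 3 + g1) * (p * U.card) ≤ ((nb G v ∩ U).card : ℝ))
    (hBc : (Bad.card : ℝ) ≤ g1 / 8 * U.card)
    (hAU : A ⊆ U) (hBU : B ⊆ U) (hCU : C ⊆ U)
    (hA : Bad.card + 4 * (K / p) + 8 * K / (g1 * ε0 * p ^ 2) < A.card)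
    (hB : (1 / 3) * (U.card : ℝ) ≤ B.card) (hC : (2 / 3) * (U.card : ℝ) ≤ C.card) :
    ∃ a ∈ A, ∃ b ∈ B, ∃ c ∈ C, G.Adj a b ∧ G.Adj a c ∧ G.Adj b c := by
  have hp := h.p0
  have hn := h.n0
  have hK1 := h.K1
  set u := (U.card : ℝ) with hu
  have hu0 : 0 < u := lt_of_lt_of_le (by positivity) hU
  have hen : ε * n ≤ g1 / 16 * u := by
    calc ε * n ≤ (ε0 * g1 / 16) * n := by gcongr
      _ = g1 / 16 * (ε0 * n) := by ring
      _ ≤ _ := by gcongr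
  have henp : ε * (n * p) ≤ g1 / 16 * (p * u) := by nlinarith
  have henp2 : ε * (n * p ^ 2) ≤ g1 / 16 * (p ^ 2 * u) := by nlinarith [sq_nonneg p, pow_pos hp 2]
  have hKp : K / p ≤ g1 / 8 * (p * u) := by
    rw [div_le_iff₀ hp]
    rw [div_le_iff₀ (by positivity)] at hK
    have : ε0 * n * (p ^ 2 * g1) ≤ u * (p ^ 2 * g1) := by gcongr
    nlinarith
  set E5 := A.filter (fun a => g1 / 8 * (p * u) < ((univ.filter (fun b => exP Γ G n p ε U a b)).card : ℝ)) with hE5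
  have hE5c : (E5.card : ℝ) ≤ 8 * K / (g1 * ε0 * p ^ 2) := by
    have h1 := card_pairs_le E5 univ (fun a b => exP Γ G n p ε U a b) (K / p) (by
      intro b _
      refine le_trans ?_ (h.qr.ldisc b (nb G b ∩ U) (inter_subset_left.trans (h.subnb b)))
      gcongr
      intro a ha
      exact mem_filter.2 (mem_filter.1 ha).2)
    have h2 : E5.card * (g1 / 8 * (p * u)) ≤ ∑ a ∈ E5, ((univ.filter (fun b => exP Γ G n p ε U a b)).card : ℝ) := by
      rw [← nsmul_eq_mul, ← sum_const]
      apply sum_le_sum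
      intro a ha
      exact (mem_filter.1 ha).2.le
    have h3 := h2.trans h1
    rw [card_univ, h.card] at h3
    have h4 : (E5.card : ℝ) * (g1 / 8 * (p * (ε0 * n))) ≤ E5.card * (g1 / 8 * (p * u)) := by gcongr
    have h5 := h4.trans h3
    rw [le_div_iff₀ (by positivity)]
    have h6 : p * n * ((E5.card : ℝ) * (g1 * ε0 * p ^ 2)) ≤ p * n * (8 * K) := by
      have : n * (K / p) * (8 * p ^ 2) = p * n * (8 * K) := by field_simp
      rw [← this]
      nlinarith [pow_pos hp 2]
    exact le_of_mul_le_mul_left h6 (by positivity)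
  have : ∃ a ∈ A, a ∉ Bad ∪ exc Γ n p ε U ∪ exc Γ n p ε (U \ B) ∪ exc Γ n p ε (U \ C) ∪ exc Γ n p ε Bad ∪ E5 := by
    by_contra hc
    push Not at hc
    have hle := card_le_card (show A ⊆ _ from hc)
    have e1 := h.exc_card U
    have e2 := h.exc_card (U \ B)
    have e3 := h.exc_card (U \ C)
    have e4 := h.exc_card Bad
    have f1 := card_union_le (Bad ∪ exc Γ n p ε U ∪ exc Γ n p ε (U \ B) ∪ exc Γ n p ε (U \ C) ∪ exc Γ n p ε Bad) E5
    have f2 := card_union_le (Bad ∪ exc Γ n p ε U ∪ exc Γ n p ε (U \ B) ∪ exc Γ n p ε (U \ C)) (exc Γ n p ε Bad)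
    have f3 := card_union_le (Bad ∪ exc Γ n p ε U ∪ exc Γ n p ε (U \ B)) (exc Γ n p ε (U \ C))
    have f4 := card_union_le (Bad ∪ exc Γ n p ε U) (exc Γ n p ε (U \ B))
    have f5 := card_union_le Bad (exc Γ n p ε U)
    have : A.card ≤ Bad.card + (exc Γ n p ε U).card + (exc Γ n p ε (U \ B)).card
      + (exc Γ n p ε (U \ C)).card + (exc Γ n p ε Bad).card + E5.card := by omega
    have : (A.card : ℝ) ≤ Bad.card + (exc Γ n p ε U).card + (exc Γ n p ε (U \ B)).card
      + (exc Γ n p ε (U \ C)).card + (exc Γ n p ε Bad).card + E5.card := by exact_mod_cast this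
    linarith
  obtain ⟨a, haA, ha⟩ := this
  simp only [mem_union, not_or] at ha
  obtain ⟨⟨⟨⟨⟨ha1, ha2⟩, ha3⟩, ha4⟩, ha5⟩, ha6⟩ := ha
  have d0 := hBad a ha1
  have d2 := not_exc ha2
  have d3 := not_exc ha3
  have d4 := not_exc ha4
  have d5 := not_exc ha5
  have d6 : ((univ.filter (fun b => exP Γ G n p ε U a b)).card : ℝ) ≤ g1 / 8 * (p * u) := by
    by_contra hc
    exact ha6 (mem_filter.2 ⟨haA, not_le.1 hc⟩)
  have cB : ((U \ B).card : ℝ) ≤ 2 / 3 * u := by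
    rw [cast_card_sdiff hBU]; linarith
  have cC : ((U \ C).card : ℝ) ≤ 1 / 3 * u := by
    rw [cast_card_sdiff hCU]; linarith
  have s1 := h.inter_split a hBU
  have s2 := h.inter_split a hCU
  have m1 := mul_le_mul_of_nonneg_left cB hp.le
  have m2 := mul_le_mul_of_nonneg_left cC hp.le
  have m3 := mul_le_mul_of_nonneg_left hBc hp.le
  set Ba := (nb G a ∩ B) \ Bad with hBa
  have cBa : 3 / 4 * (g1 * (p * u)) ≤ Ba.card := by
    have : nb G a ∩ B ⊆ Ba ∪ (nb Γ a ∩ Bad) := by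
      intro x hx
      by_cases hxB : x ∈ Bad
      · exact mem_union_right _ (mem_inter.2 ⟨h.subnb a (mem_inter.1 hx).1, hxB⟩)
      · exact mem_union_left _ (Finset.mem_sdiff.2 ⟨hx, hxB⟩)
    have : ((nb G a ∩ B).card : ℝ) ≤ Ba.card + (nb Γ a ∩ Bad).card := by
      exact_mod_cast (card_le_card this).trans (card_union_le _ _)
    nlinarith
  set Wa := (nb Γ a ∩ U) \ (nb G a ∩ C) with hWa
  have cWa : (Wa.card : ℝ) ≤ (2 / 3 - 7 / 8 * g1) * (p * u) := by
    have hsub : nb G a ∩ C ⊆ nb Γ a ∩ U := inter_subset_inter (h.subnb a) hCU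
    rw [hWa, cast_card_sdiff hsub]
    nlinarith
  have hWsub : Wa ⊆ nb Γ a := sdiff_subset.trans inter_subset_left
  have hl := h.qr.ldisc a Wa hWsub
  set E7 := (nb Γ a).filter (fun b => ¬ |((nb Γ b ∩ Wa).card : ℝ) - p * Wa.card| ≤ ε * (n * p ^ 2)) with hE7
  have hpu : 0 < g1 * (p * u) := by positivity
  obtain ⟨b, hb, b1, b2, _⟩ := exists_of_card (S := Ba) (A := univ.filter (fun b => exP Γ G n p ε U a b))
    (B := E7) (C := ∅) (by simp only [card_empty, Nat.cast_zero]; linarith)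
  rw [hBa, Finset.mem_sdiff, mem_inter] at hb
  have hab := mem_nb.1 hb.1.1
  have hbΓ : b ∈ nb Γ a := h.subnb a hb.1.1
  have haΓ : a ∈ nb Γ b := mem_nb.2 (mem_nb.1 hbΓ).symm
  have b1' : |((nb Γ a ∩ (nb G b ∩ U)).card : ℝ) - p * (nb G b ∩ U).card| ≤ ε * (n * p ^ 2) := by
    by_contra hc
    exact b1 (mem_filter.2 ⟨mem_univ _, haΓ, hc⟩)
  have b2' : |((nb Γ b ∩ Wa).card : ℝ) - p * Wa.card| ≤ ε * (n * p ^ 2) := by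
    by_contra hc
    exact b2 (mem_filter.2 ⟨hbΓ, hc⟩)
  have b1'' := (abs_le.1 b1').1
  have b2'' := (abs_le.1 b2').2
  have d7 := mul_le_mul_of_nonneg_left (hBad b hb.2) hp.le
  have d8 := mul_le_mul_of_nonneg_left cWa hp.le
  have hp2u : 0 < g1 * (p ^ 2 * u) := by positivity
  have hlt : ((nb Γ b ∩ Wa).card : ℝ) < (nb Γ a ∩ (nb G b ∩ U)).card := by nlinarith
  have : ∃ c ∈ nb Γ a ∩ (nb G b ∩ U), c ∉ Wa := by
    by_contra hc
    push Not at hc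
    apply not_le.2 hlt
    exact_mod_cast card_le_card (fun c hcX =>
      mem_inter.2 ⟨h.subnb b (mem_inter.1 (mem_inter.1 hcX).2).1, hc c hcX⟩)
  obtain ⟨c, hcX, hcW⟩ := this
  simp only [mem_inter] at hcX
  have : c ∈ nb G a ∩ C := by
    by_contra hc
    exact hcW (Finset.mem_sdiff.2 ⟨mem_inter.2 ⟨hcX.1, hcX.2.2⟩, hc⟩)
  rw [mem_inter] at this
  exact ⟨a, haA, b, hb.1.2, c, this.2, hab, mem_nb.1 this.1, mem_nb.1 hcX.2.1⟩

end Setup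
end BLS

namespace BLS
set_option linter.unusedSectionVars false
open Finset
open scoped Classical

variable {V : Type*} [Fintype V]
variable {Γ G : SimpleGraph V} {n p ε K g : ℝ}

lemma step_alg (Ψ Ψ' S u n p δ σ ε0 r0 F : ℝ) (hu : 6 ≤ u) (hp : 0 < p) (hn : 0 < n) (hε0 : 0 < ε0)
    (hδ : 0 < δ) (hσ : 0 < σ)
    (h1 : Ψ' ≤ Ψ + 2 / p * F - 6 * r0 * S + 27 * n / p)
    (h2 : u * F ≤ (3 + 6 * δ) * (p * (r0 * u * S - Ψ))) (hΨ : 0 ≤ Ψ) (hr1 : r0 ≤ 1)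
    (hS : 0 ≤ S) (hS2 : S ≤ n * u * σ) (hnu : ε0 * n ≤ u) (hd : 48 * δ * σ / ε0 ≤ σ ^ 2 / 2)
    (hnp : 108 / (ε0 ^ 2 * (n * p)) ≤ σ ^ 2 / 2) :
    Ψ' / (u - 3) ^ 2 ≤ Ψ / u ^ 2 + σ ^ 2 := by
  have hu0 : 0 < u := by linarith
  have a1 : F / p ≤ (3 + 6 * δ) * (r0 * S - Ψ / u) := by
    rw [div_le_iff₀ hp]
    have : (3 + 6 * δ) * (r0 * S - Ψ / u) * p = (3 + 6 * δ) * (p * (r0 * u * S - Ψ)) / u := by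
      field_simp
    rw [this, le_div_iff₀ hu0]; linarith
  have a2 : 2 / p * F = 2 * (F / p) := by ring
  have a3 : 0 ≤ Ψ / u := by positivity
  have a4 : r0 * S ≤ S := by nlinarith
  have a5 : Ψ' ≤ Ψ - 6 * (Ψ / u) + (12 * δ * S + 27 * n / p) := by
    have : δ * (r0 * S) ≤ δ * S := by gcongr
    have : 0 ≤ δ * (Ψ / u) := by positivity
    nlinarith
  have b1 : 48 * δ * S ≤ σ ^ 2 / 2 * u ^ 2 := by
    calc 48 * δ * S ≤ 48 * δ * (n * u * σ) := by gcongr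
      _ = 48 * δ * σ / ε0 * (ε0 * n) * u := by field_simp
      _ ≤ 48 * δ * σ / ε0 * u * u := by gcongr
      _ ≤ σ ^ 2 / 2 * u * u := by gcongr
      _ = _ := by ring
  have b2 : 108 * n / p ≤ σ ^ 2 / 2 * u ^ 2 := by
    calc 108 * n / p = 108 / (ε0 ^ 2 * (n * p)) * (ε0 * n) ^ 2 := by field_simp
      _ ≤ σ ^ 2 / 2 * u ^ 2 := by gcongr
  have b3 : 12 * δ * S + 27 * n / p ≤ σ ^ 2 * (u ^ 2 / 4) := by
    have : 27 * n / p = (108 * n / p) / 4 := by ring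
    linarith
  rw [div_le_iff₀ (by nlinarith)]
  have c1 : Ψ - 6 * (Ψ / u) = (Ψ / u ^ 2) * (u * (u - 6)) := by field_simp
  have c2 : (Ψ / u ^ 2) * (u * (u - 6)) ≤ (Ψ / u ^ 2) * (u - 3) ^ 2 := by
    have : 0 ≤ Ψ / u ^ 2 := by positivity
    gcongr
    nlinarith
  have c3 : σ ^ 2 * (u ^ 2 / 4) ≤ σ ^ 2 * (u - 3) ^ 2 := by
    gcongr
    nlinarith
  nlinarith

/-- the deficiency of a vertex -/
noncomputable def short (G : SimpleGraph V) (p r : ℝ) (U : Finset V) (v : V) : ℝ :=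
  max 0 (r * U.card - (nb G v ∩ U).card / p)

noncomputable def Psi (G : SimpleGraph V) (p r : ℝ) (U : Finset V) : ℝ := ∑ v, (short G p r U v) ^ 2

lemma short_nonneg (p r : ℝ) (U : Finset V) (v : V) : 0 ≤ short G p r U v := le_max_left _ _

lemma wdc (X : Finset V) (w : V → ℝ) :
    ∑ v, w v * ((nb G v ∩ X).card : ℝ) = ∑ x ∈ X, ∑ v ∈ nb G x, w v := by
  have h1 : ∀ v, w v * ((nb G v ∩ X).card : ℝ) = ∑ x ∈ X, if G.Adj v x then w v else 0 := by
    intro v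
    rw [← sum_filter, sum_const, nsmul_eq_mul, mul_comm]
    congr 3
    ext y
    simp [mem_nb, and_comm]
  simp_rw [h1]
  rw [sum_comm]
  apply sum_congr rfl
  intro x _
  rw [nb, sum_filter]
  simp_rw [G.adj_comm]

lemma short_mul (hp : 0 < p) (r : ℝ) (U : Finset V) (v : V) :
    short G p r U v * ((nb G v ∩ U).card : ℝ) = p * (r * U.card * short G p r U v - (short G p r U v) ^ 2) := by
  unfold short
  rcases le_total 0 (r * U.card - (nb G v ∩ U).card / p) with h | h
  · rw [max_eq_right h]; field_simp; ring
  · rw [max_eq_left h]; ring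

lemma short_step (hp : 0 < p) (r : ℝ) (U : Finset V) (t : Finset V) (ht : t ⊆ U) (htc : t.card = 3) (v : V)
    (hr0 : 0 ≤ r) (hr1 : r ≤ 1) :
    (short G p r (U \ t) v) ^ 2 ≤ (short G p r U v) ^ 2
      + 2 / p * (short G p r U v * (nb G v ∩ t).card) - 6 * r * short G p r U v
      + (3 / p ^ 2 * (nb G v ∩ t).card + 9) := by
  have h1 : ((nb G v ∩ (U \ t)).card : ℝ) = (nb G v ∩ U).card - (nb G v ∩ t).card := by
    have : nb G v ∩ (U \ t) = (nb G v ∩ U) \ (nb G v ∩ t) := by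
      ext x; simp only [mem_inter, Finset.mem_sdiff]; tauto
    rw [this, cast_card_sdiff (inter_subset_inter_left ht)]
  have h2 : (((U \ t).card : ℕ) : ℝ) = U.card - 3 := by
    rw [cast_card_sdiff ht, htc]; norm_num
  have hj3 : ((nb G v ∩ t).card : ℝ) ≤ 3 := by
    have : (nb G v ∩ t).card ≤ t.card := card_le_card inter_subset_right
    rw [htc] at this; exact_mod_cast this
  set j := ((nb G v ∩ t).card : ℝ) with hj
  have hj0 : 0 ≤ j := by positivity
  set s := short G p r U v with hs
  have hs1 : r * U.card - (nb G v ∩ U).card / p ≤ s := le_max_right _ _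
  have h3 : short G p r (U \ t) v ≤ max 0 (s - 3 * r + j / p) := by
    unfold short
    apply max_le_max le_rfl
    rw [h1, h2, sub_div]
    linarith
  have h4 : (short G p r (U \ t) v) ^ 2 ≤ (s - 3 * r + j / p) ^ 2 := by
    have h5 : (short G p r (U \ t) v) ^ 2 ≤ (max 0 (s - 3 * r + j / p)) ^ 2 := by
      have := short_nonneg (G := G) p r (U \ t) v
      gcongr
    refine h5.trans ?_
    rcases le_total 0 (s - 3 * r + j / p) with h | h
    · rw [max_eq_right h]
    · rw [max_eq_left h]; simpa using sq_nonneg (s - 3 * r + j / p)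
  refine h4.trans ?_
  have e1 : (s - 3 * r + j / p) ^ 2 = s ^ 2 + 2 / p * (s * j) - 6 * r * s + (j ^ 2 / p ^ 2 - 6 * r * (j / p) + 9 * r ^ 2) := by
    field_simp; ring
  rw [e1]
  have e2 : j ^ 2 / p ^ 2 ≤ 3 / p ^ 2 * j := by
    have : 3 / p ^ 2 * j = (3 * j) / p ^ 2 := by ring
    rw [this]
    gcongr
    nlinarith
  have e3 : 0 ≤ 6 * r * (j / p) := by positivity
  nlinarith

namespace Setup

lemma Psi_step (h : Setup Γ G n p ε K g) (r : ℝ) (hr0 : 0 ≤ r) (hr1 : r ≤ 1) (U : Finset V) (t : V × V × V)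
    (ht : t ∈ tri G) (htU : vs t ⊆ U) :
    Psi G p r (U \ vs t) ≤ Psi G p r U + 2 / p * ((∑ v ∈ nb G t.1, short G p r U v)
      + (∑ v ∈ nb G t.2.1, short G p r U v) + (∑ v ∈ nb G t.2.2, short G p r U v))
      - 6 * r * (∑ v, short G p r U v) + 27 * n / p := by
  have hp := h.p0
  have hn := h.n0
  have htr := mem_tri.1 ht
  have hsumvs : ∀ F : V → ℝ, ∑ x ∈ vs t, F x = F t.1 + F t.2.1 + F t.2.2 := by
    intro F
    unfold vs
    rw [sum_insert (by simp [htr.1.ne, htr.2.1.ne]), sum_insert (by simp [htr.2.2.ne]), sum_singleton]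
    ring
  have h1 : Psi G p r (U \ vs t) ≤ ∑ v, ((short G p r U v) ^ 2
      + 2 / p * (short G p r U v * (nb G v ∩ vs t).card) - 6 * r * short G p r U v
      + (3 / p ^ 2 * (nb G v ∩ vs t).card + 9)) :=
    sum_le_sum (fun v _ => short_step hp r U (vs t) htU (vs_card ht) v hr0 hr1)
  refine h1.trans ?_
  rw [sum_add_distrib, sum_sub_distrib, sum_add_distrib, ← mul_sum, ← mul_sum, sum_add_distrib, ← mul_sum,
    wdc (vs t) (fun v => short G p r U v), hsumvs]
  have h2 : ∑ v, ((nb G v ∩ vs t).card : ℝ) ≤ 6 * (n * p) := by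
    have := wdc (G := G) (vs t) (fun _ => (1:ℝ))
    simp only [one_mul, sum_const, nsmul_eq_mul, mul_one] at this
    rw [this, hsumvs]
    have : ∀ v, ((nb G v).card : ℝ) ≤ 2 * (n * p) := fun v =>
      le_trans (by exact_mod_cast card_le_card (h.subnb v)) (h.degle v)
    linarith [this t.1, this t.2.1, this t.2.2]
  have h3 : ∑ v : V, (9:ℝ) = 9 * n := by simp [h.card, mul_comm]
  rw [h3]
  have h4 : 3 / p ^ 2 * ∑ v, ((nb G v ∩ vs t).card : ℝ) ≤ 18 * n / p := by
    calc _ ≤ 3 / p ^ 2 * (6 * (n * p)) := by gcongr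
      _ = _ := by field_simp; norm_num
  have h5 : 9 * n ≤ 9 * n / p := by
    rw [le_div_iff₀ hp]; have := h.p1; nlinarith
  have h6 : 27 * n / p = 18 * n / p + 9 * n / p := by ring
  have h7 : ∑ v, short G p r U v ^ 2 = Psi G p r U := rfl
  linarith

set_option maxHeartbeats 1000000 in
lemma step (h : Setup Γ G n p ε K g) (U : Finset V) (ε0 σ δ : ℝ) (hε0 : 0 < ε0) (hε1 : ε0 ≤ 1)
    (hσ : σ = g ^ 2 * ε0 ^ 2 / 10000) (hδ : δ = 64 * σ ^ 2 / (g ^ 2 * ε0))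
    (hU : ε0 * n ≤ U.card) (hεε : ε ≤ ε0 * g / 64)
    (hN1 : 512 * K / (g * ε0 ^ 2 * δ) ≤ n * p ^ 2) (hN2 : 216 / (ε0 ^ 2 * σ ^ 2) ≤ n * p ^ 2)
    (hΨ : Psi G p (2 / 3 + g / 2) U ≤ σ ^ 2 * n * U.card ^ 2) :
    ∃ t ∈ tri G, vs t ⊆ U ∧ Psi G p (2 / 3 + g / 2) (U \ vs t) / ((U \ vs t).card : ℝ) ^ 2 ≤
      Psi G p (2 / 3 + g / 2) U / (U.card : ℝ) ^ 2 + σ ^ 2 := by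
  have hp := h.p0
  have hn := h.n0
  have hg := h.g0
  have hg1 := h.g1
  have hp1 := h.p1
  have hK1 := h.K1
  have hσ0 : 0 < σ := by rw [hσ]; positivity
  have hδ0 : 0 < δ := by rw [hδ]; positivity
  have hσ1 : σ ≤ g ^ 2 * ε0 / 10000 := by
    rw [hσ]
    have : ε0 ^ 2 ≤ ε0 := by nlinarith
    gcongr
  have hσ2 : σ ≤ 1 / 10000 := by
    rw [hσ]
    have : g ^ 2 * ε0 ^ 2 ≤ 1 * 1 := by
      gcongr
      · nlinarith
      · nlinarith
    linarith
  have hδg : δ ≤ g / 8 := by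
    rw [hδ, div_le_iff₀ (by positivity)]
    have : σ ^ 2 ≤ (g ^ 2 * ε0 / 10000) * (1 / 10000) := by
      rw [sq]; gcongr
    have h3 : g ^ 2 * ε0 * g ≥ 0 := by positivity
    have h4 : 64 * ((g ^ 2 * ε0 / 10000) * (1 / 10000)) ≤ g / 8 * (g ^ 2 * ε0) ∨ True := Or.inr trivial
    have h5 : σ ^ 2 ≤ (g ^ 2 * ε0 / 10000) * (g / 10000) := by
      rw [sq]
      have : σ ≤ g / 10000 := by
        refine hσ1.trans ?_
        have : g ^ 2 * ε0 ≤ g * 1 := by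
          have : g ^ 2 ≤ g := by nlinarith
          gcongr
        linarith
      gcongr
    nlinarith
  set u := (U.card : ℝ) with hu
  set r := 2 / 3 + g / 2 with hr
  have hnn : n * p ^ 2 ≤ n := by
    have : p ^ 2 ≤ 1 := by nlinarith
    nlinarith
  have hu6 : 6 ≤ u := by
    have h1 : 216 / (ε0 ^ 2 * σ ^ 2) ≤ n := hN2.trans hnn
    rw [div_le_iff₀ (by positivity)] at h1
    have h2 : ε0 ^ 2 * σ ^ 2 ≤ ε0 * 1 := by
      gcongr
      · nlinarith
      · nlinarith
    have : n * (ε0 ^ 2 * σ ^ 2) ≤ n * (ε0 * 1) := by gcongr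
    linarith
  have hu0 : 0 < u := by linarith
  set s := short G p r U with hs
  have hs0 : ∀ v, 0 ≤ s v := fun v => short_nonneg p r U v
  set Bad := univ.filter (fun v => g / 4 * u < s v) with hBad
  have hBadc : (Bad.card : ℝ) ≤ δ / 4 * u := by
    have h1 : (Bad.card : ℝ) * (g / 4 * u) ^ 2 ≤ Psi G p r U := by
      calc (Bad.card : ℝ) * (g / 4 * u) ^ 2 = ∑ v ∈ Bad, (g / 4 * u) ^ 2 := by simp
        _ ≤ ∑ v ∈ Bad, (s v) ^ 2 := by
            apply sum_le_sum
            intro v hv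
            have := (mem_filter.1 hv).2.le
            gcongr
        _ ≤ _ := sum_le_sum_of_subset_of_nonneg (subset_univ _) (fun v _ _ => sq_nonneg _)
    have h2 := h1.trans hΨ
    have h3 : u ^ 2 * ((Bad.card : ℝ) * (g / 4) ^ 2) ≤ u ^ 2 * (σ ^ 2 * n) := by nlinarith
    have h4 := le_of_mul_le_mul_left h3 (by positivity)
    have h5 : σ ^ 2 = δ * (g ^ 2 * ε0) / 64 := by rw [hδ]; field_simp
    have h6 : g ^ 2 * (Bad.card : ℝ) ≤ g ^ 2 * (δ / 4 * (ε0 * n)) := by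
      rw [h5] at h4; nlinarith
    have h7 := le_of_mul_le_mul_left h6 (by positivity)
    have : δ / 4 * (ε0 * n) ≤ δ / 4 * u := by gcongr
    linarith
  have hUne : U.Nonempty := by
    rw [← card_pos]
    have : (0:ℝ) < (U.card : ℝ) := hu0
    exact_mod_cast this
  obtain ⟨A, B, C, hAU, hBU, hCU, hA, hB, hC, hABC⟩ := three_quant U (fun x => ∑ v ∈ nb G x, s v)
    (fun x => sum_nonneg (fun v _ => hs0 v)) δ hδ0 (by linarith) hUne
  have hKp2 : 8 * K / (g / 4 * ε0 * p ^ 2) ≤ δ * u / 8 := by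
    rw [div_le_iff₀ (by positivity)] at hN1
    rw [div_le_iff₀ (by positivity)]
    have : ε0 * n * (g * ε0 * δ * p ^ 2) ≤ u * (g * ε0 * δ * p ^ 2) := by gcongr
    nlinarith
  have hKp : 4 * (K / p) ≤ δ * u / 8 := by
    refine le_trans ?_ hKp2
    rw [← mul_div_assoc, div_le_div_iff₀ hp (by positivity)]
    have h1 : g / 4 * ε0 * p ^ 2 ≤ 1 * p := by
      have h1 : g / 4 * ε0 ≤ 1 * 1 := by gcongr; linarith
      have h2 : p ^ 2 ≤ p := by nlinarith
      calc g / 4 * ε0 * p ^ 2 ≤ (1 * 1) * p := by gcongr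
        _ = _ := by ring
    nlinarith
  obtain ⟨a, haA, b, hbB, c, hcC, e1, e2, e3⟩ := h.key U Bad A B C (g / 4) ε0 (by positivity) hε0 hU
    (by linarith) (by
      refine le_trans ?_ hN1
      rw [div_le_div_iff₀ (by positivity) (by positivity)]
      have : g * ε0 ^ 2 * δ ≤ g * ε0 * 1 := by
        gcongr
        · nlinarith
        · linarith
      have hK' : 0 < K := by linarith
      nlinarith [mul_le_mul_of_nonneg_left this hK'.le, mul_pos hg hε0, mul_pos hK' (mul_pos hg hε0)]) (by
      intro v hv
      have hv' : s v ≤ g / 4 * u := by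
        by_contra hc
        exact hv (mem_filter.2 ⟨mem_univ _, not_le.1 hc⟩)
      have h1 : r * u - (nb G v ∩ U).card / p ≤ s v := le_max_right _ _
      have h2 : (2 / 3 + g / 4) * u ≤ (nb G v ∩ U).card / p := by
        rw [hr] at h1; linarith
      rw [le_div_iff₀ hp] at h2
      linarith)
    (by
      refine hBadc.trans ?_
      have : δ / 4 ≤ g / 4 / 8 := by linarith
      gcongr) hAU hBU hCU
    (by
      have : 0 < δ * u := by positivity
      linarith) hB hC
  refine ⟨(a, b, c), mem_tri.2 ⟨e1, e2, e3⟩, ?_, ?_⟩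
  · intro v hv
    rcases mem_vs.1 hv with rfl | rfl | rfl
    · exact hAU haA
    · exact hBU hbB
    · exact hCU hcC
  have htri : (a, b, c) ∈ tri G := mem_tri.2 ⟨e1, e2, e3⟩
  have htU : vs (a, b, c) ⊆ U := by
    intro v hv
    rcases mem_vs.1 hv with rfl | rfl | rfl
    · exact hAU haA
    · exact hBU hbB
    · exact hCU hcC
  have hstep := h.Psi_step r (by positivity) (by rw [hr]; linarith) U (a, b, c) htri htU
  have hcard : ((U \ vs (a, b, c)).card : ℝ) = u - 3 := by
    rw [cast_card_sdiff htU, vs_card htri]; norm_num; exact hu.symm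
  rw [hcard]
  have hF := hABC a haA b hbB c hcC
  have hsumU : ∑ x ∈ U, ∑ v ∈ nb G x, s v = p * (r * u * ∑ v, s v - Psi G p r U) := by
    rw [← wdc U s]
    simp_rw [hs, short_mul hp]
    rw [← mul_sum, sum_sub_distrib, ← mul_sum]
    rfl
  rw [hsumU] at hF
  have hS2 : ∑ v, s v ≤ n * u * σ := by
    have hcs : (∑ v, s v) ^ 2 ≤ n * Psi G p r U := by
      have := sq_sum_le_card_mul_sum_sq (s := (univ : Finset V)) (f := s)
      rw [card_univ, h.card] at this
      exact this
    have h2 : (∑ v, s v) ^ 2 ≤ (n * u * σ) ^ 2 := by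
      calc _ ≤ n * Psi G p r U := hcs
        _ ≤ n * (σ ^ 2 * n * u ^ 2) := by gcongr
        _ = _ := by ring
    exact (sq_le_sq₀ (sum_nonneg (fun v _ => hs0 v)) (by positivity)).1 h2
  refine step_alg (Psi G p r U) (Psi G p r (U \ vs (a, b, c))) (∑ v, s v) u n p δ σ ε0 r _ hu6 hp hn hε0 hδ0 hσ0
    hstep hF (sum_nonneg (fun v _ => sq_nonneg _)) (by rw [hr]; linarith) (sum_nonneg (fun v _ => hs0 v)) hS2 hU ?_ ?_
  · rw [hδ]
    have : 48 * (64 * σ ^ 2 / (g ^ 2 * ε0)) * σ / ε0 = σ ^ 2 * (3072 * σ / (g ^ 2 * ε0 ^ 2)) := by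
      field_simp; norm_num
    rw [this]
    have : 3072 * σ / (g ^ 2 * ε0 ^ 2) ≤ 1 / 2 := by
      rw [hσ, div_le_iff₀ (by positivity)]
      have : 0 < g ^ 2 * ε0 ^ 2 := by positivity
      linarith
    have := mul_le_mul_of_nonneg_left this (sq_nonneg σ)
    linarith
  · have hnp : n * p ^ 2 ≤ n * p := by
      have : p ^ 2 ≤ p := by nlinarith
      gcongr
    have h1 := hN2.trans hnp
    rw [div_le_iff₀ (by positivity)] at h1 ⊢
    linarith

end Setup
end BLS

namespace BLS
set_option linter.unusedSectionVars false
open Finset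
open scoped Classical

variable {V : Type*} [Fintype V]
variable {Γ G : SimpleGraph V} {n p ε K g : ℝ}

namespace Setup

lemma Psi_init (h : Setup Γ G n p ε K g) (W : Finset V) (hW : (W.card : ℝ) ≤ g * n / 10) :
    Psi G p (2 / 3 + g / 2) (univ \ W) / ((univ \ W).card : ℝ) ^ 2 ≤ K / p := by
  have hp := h.p0
  have hn := h.n0
  have hg := h.g0
  have hg1 := h.g1
  have hK := h.K1
  set U := univ \ W with hU
  have hUc : (U.card : ℝ) = n - W.card := by
    rw [hU, cast_card_sdiff (subset_univ _), card_univ, h.card]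
  apply div_le_of_le_mul₀ (by positivity) (by positivity)
  have h1 : ∀ v, (short G p (2 / 3 + g / 2) U v) ^ 2 ≤ if v ∈ exc Γ n p ε W then (U.card : ℝ) ^ 2 else 0 := by
    intro v
    split_ifs with hv
    · have h2 : short G p (2 / 3 + g / 2) U v ≤ U.card := by
        apply max_le (by positivity)
        have : 0 ≤ ((nb G v ∩ U).card : ℝ) / p := by positivity
        have : (2 / 3 + g / 2) * (U.card : ℝ) ≤ 1 * U.card := by
          gcongr; linarith
        linarith
      have := short_nonneg (G := G) p (2 / 3 + g / 2) U v
      gcongr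
    · have h2 := not_exc hv
      have h3 : ((nb G v).card : ℝ) ≤ (nb G v ∩ U).card + (nb Γ v ∩ W).card := by
        have : nb G v ⊆ (nb G v ∩ U) ∪ (nb Γ v ∩ W) := by
          intro x hx
          by_cases hxW : x ∈ W
          · exact mem_union_right _ (mem_inter.2 ⟨h.subnb v hx, hxW⟩)
          · exact mem_union_left _ (mem_inter.2 ⟨hx, Finset.mem_sdiff.2 ⟨mem_univ _, hxW⟩⟩)
        exact_mod_cast (card_le_card this).trans (card_union_le _ _)
      have h4 := h.hG v
      have h5 : short G p (2 / 3 + g / 2) U v = 0 := by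
        apply max_eq_left
        rw [sub_nonpos, le_div_iff₀ hp, hUc]
        have e1 : ε * (n * p) ≤ g / 10 * (n * p) := by
          have := h.eg; have := h.np0; gcongr
        have e2 : p * (W.card : ℝ) ≤ p * (g * n / 10) := by gcongr
        have e3 : 0 ≤ p * (W.card : ℝ) := by positivity
        nlinarith [mul_nonneg hg.le e3, mul_pos hg h.np0]
      rw [h5]; norm_num
  calc Psi G p (2 / 3 + g / 2) U ≤ ∑ v, if v ∈ exc Γ n p ε W then (U.card : ℝ) ^ 2 else 0 :=
        sum_le_sum (fun v _ => h1 v)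
    _ = (exc Γ n p ε W).card * (U.card : ℝ) ^ 2 := by
        rw [← sum_filter, sum_const, nsmul_eq_mul]; congr 3; ext x; simp
    _ ≤ _ := by have := h.exc_card W; gcongr

lemma near_perfect (h : Setup Γ G n p ε K g) (ε0 σ δ : ℝ) (hε0 : 0 < ε0) (hε1 : ε0 ≤ 1)
    (hσ : σ = g ^ 2 * ε0 ^ 2 / 10000) (hδ : δ = 64 * σ ^ 2 / (g ^ 2 * ε0))
    (hεε : ε ≤ ε0 * g / 64)
    (hN1 : 512 * K / (g * ε0 ^ 2 * δ) ≤ n * p ^ 2) (hN2 : 216 / (ε0 ^ 2 * σ ^ 2) ≤ n * p ^ 2)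
    (hN3 : 2 * K / σ ^ 2 ≤ n * p ^ 2)
    (T0 : Finset (V × V × V)) (hT0 : IsPack G T0) (hm : 3 * (T0.card : ℝ) ≤ g * n / 10) :
    ∃ Q, IsPack G Q ∧ T0 ⊆ Q ∧ ((univ \ cover Q).card : ℝ) ≤ ε0 * n := by
  have hp := h.p0
  have hn := h.n0
  have hg := h.g0
  have hσ0 : 0 < σ := by rw [hσ]; positivity
  have hcT : ((cover T0).card : ℝ) = 3 * T0.card := by exact_mod_cast cover_card hT0
  have hinit := h.Psi_init (cover T0) (by rw [hcT]; exact hm)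
  set U0 := univ \ cover T0 with hU0
  set r := 2 / 3 + g / 2 with hr
  set F := (univ : Finset (Finset (V × V × V))).filter (fun Q => IsPack G Q ∧ cover Q ⊆ U0 ∧
    Psi G p r (U0 \ cover Q) / ((U0 \ cover Q).card : ℝ) ^ 2 ≤ K / p + Q.card * σ ^ 2) with hF
  have hne : F.Nonempty := ⟨∅, by
    rw [hF, mem_filter]
    refine ⟨mem_univ _, ⟨by simp, by simp⟩, by simp [cover], ?_⟩
    simpa [cover] using hinit⟩
  obtain ⟨Q, hQF, hmax⟩ := exists_max_image F Finset.card hne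
  rw [hF, mem_filter] at hQF
  obtain ⟨_, hQ, hQU, hQP⟩ := hQF
  have hdis : Disjoint (cover T0) (cover Q) := by
    rw [disjoint_left]
    intro v hv hvQ
    exact (Finset.mem_sdiff.1 (hQU hvQ)).2 hv
  have hun := pack_union hT0 hQ hdis
  refine ⟨T0 ∪ Q, hun.1, subset_union_left, ?_⟩
  rw [hun.2]
  have e : univ \ (cover T0 ∪ cover Q) = U0 \ cover Q := by
    ext x; simp [hU0]
  rw [e]
  by_contra hcon
  push Not at hcon
  set U := U0 \ cover Q with hU
  have hUpos : (0:ℝ) < U.card := lt_trans (by positivity) hcon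
  have hKn : K / p ≤ σ ^ 2 * n / 2 := by
    rw [div_le_iff₀ (by positivity)] at hN3
    rw [div_le_iff₀ hp]
    have : n * p ^ 2 ≤ n * p := by
      have : p ^ 2 ≤ p := by have := h.p1; nlinarith
      gcongr
    nlinarith [pow_pos hσ0 2]
  have hQn : (Q.card : ℝ) ≤ n / 2 := by
    have h1 : ((cover Q).card : ℝ) = 3 * Q.card := by exact_mod_cast cover_card hQ
    have h2 : ((cover Q).card : ℝ) ≤ n := by rw [← h.card]; exact_mod_cast card_le_univ _
    linarith
  have hPsi : Psi G p r U ≤ σ ^ 2 * n * (U.card : ℝ) ^ 2 := by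
    rw [div_le_iff₀ (by positivity)] at hQP
    refine hQP.trans ?_
    gcongr
    nlinarith [pow_pos hσ0 2]
  obtain ⟨t, ht, htU, hst⟩ := h.step U ε0 σ δ hε0 hε1 hσ hδ hcon.le hεε hN1 hN2 hPsi
  have hd : Disjoint (vs t) (cover Q) := by
    rw [disjoint_left]
    intro v hv
    exact (Finset.mem_sdiff.1 (htU hv)).2
  obtain ⟨i1, i2, i3⟩ := pack_insert hQ ht hd
  have hmem : insert t Q ∈ F := by
    rw [hF, mem_filter]
    refine ⟨mem_univ _, i1, ?_, ?_⟩
    · rw [i3]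
      exact union_subset (htU.trans sdiff_subset) hQU
    · have e2 : U0 \ cover (insert t Q) = U \ vs t := by
        rw [i3]; ext x; simp only [hU, Finset.mem_sdiff, mem_union]; tauto
      rw [e2, i2]
      push_cast
      linarith
  have := hmax _ hmem
  omega

end Setup
end BLS

namespace BLS
set_option linter.unusedSectionVars false
open Finset
open scoped Classical

variable {V : Type*} [Fintype V]
variable {Γ G : SimpleGraph V} {n p ε K g : ℝ}

namespace Setup

set_option maxHeartbeats 1000000 in
/-- deterministic conclusion -/
lemma conclude (h : Setup Γ G n p ε K g) (ε0 σ δ D : ℝ) (hε0 : ε0 = g ^ 2 / 10 ^ 12)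
    (hσ : σ = g ^ 2 * ε0 ^ 2 / 10000) (hδ : δ = 64 * σ ^ 2 / (g ^ 2 * ε0))
    (hεε : ε ≤ ε0 * g / 64) (hN1 : 512 * K / (g * ε0 ^ 2 * δ) ≤ n * p ^ 2)
    (hN2 : 216 / (ε0 ^ 2 * σ ^ 2) ≤ n * p ^ 2) (hN3 : 2 * K / σ ^ 2 ≤ n * p ^ 2)
    (hN4 : 8 * K / ε ≤ n * p ^ 2) (hN5 : 2 * K / ε0 ≤ n * p ^ 2)
    (hD1 : 200 * K ≤ D) (hD2 : 2 * K / ε ≤ D) (hlog1 : 1 ≤ Real.log n)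
    (hlog : 4 * D * Real.log n ≤ ε0 * (n * p ^ 2)) :
    ∃ P, IsPack G P ∧ ((univ \ cover P).card : ℝ) ≤ 6 * D / p ^ 2 := by
  have hp := h.p0
  have hp1 := h.p1
  have hn := h.n0
  have hg := h.g0
  have hg1 := h.g1
  have hK := h.K1
  have he := h.e0
  have hp2 : 0 < p ^ 2 := by positivity
  have hp21 : p ^ 2 ≤ 1 := by nlinarith
  have hr0 : 0 ≤ g * n := by positivity
  have heps0p : 0 < ε0 := by rw [hε0]; positivity
  have hε01 : ε0 ≤ 1 := by rw [hε0]; nlinarith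
  have hnn : n * p ^ 2 ≤ n := by nlinarith
  have hnbig : 921600 / g ≤ n := by
    have h1 : 2 / ε0 ≤ n := by
      refine le_trans ?_ (le_trans hN5 hnn)
      gcongr; linarith
    refine le_trans ?_ h1
    rw [hε0, div_div_eq_mul_div, div_le_div_iff₀ hg (by positivity)]
    nlinarith
  have hgn : 921600 ≤ g * n := by rwa [div_le_iff₀' hg] at hnbig
  set m : ℕ := ⌊g * n / 460800⌋₊ with hm
  have hmle : (m : ℝ) ≤ g * n / 460800 := Nat.floor_le (by positivity)
  have hmge : g * n / 921600 ≤ m := by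
    have := Nat.lt_floor_add_one (g * n / 460800)
    rw [← hm] at this
    linarith
  set r : ℝ := g * m / 409600 with hr
  have hrge : ε0 * n ≤ r / 2 := by
    have : g * (g * n / 921600) ≤ g * m := by gcongr
    rw [hr, hε0]
    nlinarith [mul_pos (mul_pos hg hg) hn]
  have hDpos : 1 ≤ D := by linarith
  set s : ℕ := ⌈D / p ^ 2⌉₊ with hs
  have hsge : D / p ^ 2 ≤ s := Nat.le_ceil _
  have hsge' : D ≤ p ^ 2 * s := by rwa [div_le_iff₀' hp2] at hsge
  have hDp : 1 ≤ D / p ^ 2 := by rw [le_div_iff₀ hp2]; linarith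
  have hsle : (s : ℝ) ≤ 2 * (D / p ^ 2) := by
    have := Nat.ceil_lt_add_one (show 0 ≤ D / p ^ 2 by positivity)
    rw [← hs] at this
    linarith
  set q : ℕ := ⌊K / p⌋₊ + 1 with hq
  have hqgt : K / p < q := by rw [hq]; push_cast; exact Nat.lt_floor_add_one _
  have hKp1 : 1 ≤ K / p := by rw [le_div_iff₀ hp]; linarith
  have hqle : (q : ℝ) ≤ 2 * (K / p) := by
    have := Nat.floor_le (show 0 ≤ K / p by positivity)
    rw [hq]; push_cast; linarith
  have hKpn : 2 * (K / p) ≤ ε0 * n := by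
    rw [← mul_div_assoc, div_le_iff₀ hp]
    rw [div_le_iff₀ heps0p] at hN5
    have h1 : n * p ^ 2 ≤ n * p := by
      have : p ^ 2 ≤ p := by nlinarith
      gcongr
    have h2 := mul_le_mul_of_nonneg_left h1 heps0p.le
    linarith
  have hKD : 2 * (K / p) ≤ D / p ^ 2 := by
    rw [← mul_div_assoc, div_le_div_iff₀ hp hp2]
    have h1 : p ^ 2 ≤ p := by nlinarith
    calc 2 * K * p ^ 2 ≤ D * p ^ 2 := by gcongr; linarith
      _ ≤ D * p := by gcongr
  obtain ⟨T0, hT0, hT0c, hA⟩ := h.exists_absorber s q m r (hD1.trans hsge') (hD2.trans hsge') hN4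
    hqgt (by linarith) (by linarith) (by rw [hr]; linarith) (by
      have h1 : ((2 * s + q : ℕ) : ℝ) ≤ 5 * D / p ^ 2 := by
        push_cast
        rw [mul_div_assoc]; linarith
      have h2 : n ^ (2 * s + q) = Real.exp ((2 * s + q : ℕ) * Real.log n) := by
        rw [Real.exp_nat_mul, Real.exp_log hn]
      have h3 : (2 : ℝ) ≤ Real.exp 1 := by
        have := Real.add_one_le_exp (1:ℝ); linarith
      rw [h2]
      calc _ ≤ Real.exp 1 * Real.exp ((2 * s + q : ℕ) * Real.log n) := by gcongr
        _ = Real.exp (1 + (2 * s + q : ℕ) * Real.log n) := by rw [Real.exp_add]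
        _ ≤ _ := by
          apply Real.exp_le_exp.2
          have h4 : (1:ℝ) ≤ D / p ^ 2 * Real.log n := one_le_mul_of_one_le_of_one_le hDp hlog1
          have h5 : ((2 * s + q : ℕ) : ℝ) * Real.log n ≤ 5 * D / p ^ 2 * Real.log n := by gcongr
          have h6 : 4 * (D / p ^ 2 * Real.log n) ≤ ε0 * n := by
            have : D / p ^ 2 * Real.log n = D * Real.log n / p ^ 2 := by ring
            rw [this, ← mul_div_assoc, div_le_iff₀ hp2]
            linarith
          have h7 : 5 * D / p ^ 2 * Real.log n = 5 * (D / p ^ 2 * Real.log n) := by ring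
          have h8 : g / 51200 * (m:ℝ) / 4 = 2 * r := by rw [hr]; ring
          rw [h8]; linarith)
  obtain ⟨Q, hQ, hTQ, hQc⟩ := h.near_perfect ε0 σ δ heps0p hε01 hσ hδ hεε hN1 hN2 hN3 T0 hT0
    (by rw [hT0c]; linarith [mul_pos hg hn])
  obtain ⟨P, hP, hPc⟩ := absorb_all hA hQ hTQ (hQc.trans (by linarith))
  refine ⟨P, hP, ?_⟩
  have : ((univ \ cover P).card : ℝ) ≤ 3 * s := by exact_mod_cast hPc.le
  rw [mul_div_assoc]; linarith

end Setup
end BLS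

namespace BLS
open Finset
open scoped Classical


lemma ber_eq {p : ℝ} (h0 : 0 ≤ p) (h1 : p ≤ 1) : bernoulliMeasure p =
   ENNReal.ofReal p • Measure.dirac true + ENNReal.ofReal (1 - p) • Measure.dirac false := by
  have : ENNReal.ofReal p ≤ 1 := by simpa using h1
  rw [bernoulliMeasure, min_eq_left this, ENNReal.ofReal_sub _ h0, ENNReal.ofReal_one]

lemma ber_prob {p : ℝ} (h0 : 0 ≤ p) (h1 : p ≤ 1) : IsProbabilityMeasure (bernoulliMeasure p) := by
  constructor
  rw [ber_eq h0 h1]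
  simp [← ENNReal.ofReal_add h0 (sub_nonneg.2 h1)]

lemma gnp_prob {n : ℕ} {p : ℝ} (h0 : 0 ≤ p) (h1 : p ≤ 1) : IsProbabilityMeasure (gnp n p) := by
  have := ber_prob h0 h1
  unfold gnp; infer_instance

lemma ber_integral {p : ℝ} (h0 : 0 ≤ p) (h1 : p ≤ 1) (f : Bool → ℝ) :
    ∫ b, f b ∂(bernoulliMeasure p) = p * f true + (1 - p) * f false := by
  have := Measure.smul_finite (Measure.dirac true) (c := ENNReal.ofReal p) ENNReal.ofReal_ne_top
  have := Measure.smul_finite (Measure.dirac false) (c := ENNReal.ofReal (1 - p)) ENNReal.ofReal_ne_top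
  rw [ber_eq h0 h1, integral_add_measure .of_finite .of_finite, integral_smul_measure, integral_smul_measure,
   integral_dirac, integral_dirac]
  simp [ENNReal.toReal_ofReal h0, ENNReal.toReal_ofReal (sub_nonneg.2 h1)]

/-- product test -/
lemma prod_test {n : ℕ} {p : ℝ} (h0 : 0 ≤ p) (h1 : p ≤ 1) (f : Sym2 (Fin n) → Bool → ℝ)
    (hf : ∀ e b, 0 ≤ f e b) (c : ℝ) (hc : 0 < c) (S : Set (Sym2 (Fin n) → Bool))
    (hS : ∀ ω ∈ S, c ≤ ∏ e, f e (ω e)) :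
    (gnp n p).real S ≤ c⁻¹ * ∏ e, (p * f e true + (1 - p) * f e false) := by
  have := ber_prob h0 h1
  have := gnp_prob (n := n) h0 h1
  have e1 : ∫ ω, ∏ e, f e (ω e) ∂(gnp n p) = ∏ e, (p * f e true + (1 - p) * f e false) := by
    unfold gnp
    rw [integral_fintype_prod_eq_prod (fun e b => f e b)]
    simp_rw [ber_integral h0 h1]
  rw [← e1]
  have h2 := mul_meas_ge_le_integral_of_nonneg (μ := gnp n p) (f := fun ω => ∏ e, f e (ω e))
    (Filter.Eventually.of_forall fun ω => prod_nonneg fun e _ => hf e _) .of_finite c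
  have h3 : (gnp n p).real S ≤ (gnp n p).real {ω | c ≤ ∏ e, f e (ω e)} := measureReal_mono hS
  rw [inv_mul_eq_div, le_div_iff₀' hc]
  exact le_trans (by gcongr) h2

lemma exp_quad {x : ℝ} (hx : |x| ≤ 1) : Real.exp x ≤ 1 + x + x ^ 2 := by
  have := (abs_le.1 (Real.abs_exp_sub_one_sub_id_le hx)).2
  linarith

/-- Chernoff bound together with a set of required edges -/
lemma chern {n : ℕ} {p : ℝ} (h0 : 0 ≤ p) (h1 : p ≤ 1) (Q : Finset (Sym2 (Fin n)))
    (a : Sym2 (Fin n) → ℝ) (ha : ∀ e, |a e| ≤ 1) (haQ : ∀ e ∈ Q, a e = 0) (t : ℝ) :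
    (gnp n p).real {ω | (∀ e ∈ Q, ω e = true) ∧ t ≤ ∑ e, a e * (if ω e = true then 1 else 0)} ≤
      p ^ Q.card * Real.exp (-t + p * ∑ e, (a e + a e ^ 2)) := by
  set f : Sym2 (Fin n) → Bool → ℝ := fun e b =>
    if e ∈ Q then (if b = true then 1 else 0) else Real.exp (a e * (if b = true then 1 else 0)) with hf
  have hf0 : ∀ e b, 0 ≤ f e b := by
    intro e b; simp only [hf]; split_ifs <;> positivity
  refine le_trans (prod_test h0 h1 f hf0 (Real.exp t) (Real.exp_pos _) _ ?_) ?_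
  · rintro ω ⟨hQ, ht⟩
    have : ∏ e, f e (ω e) = ∏ e, Real.exp (a e * (if ω e = true then 1 else 0)) := by
      refine prod_congr rfl fun e _ => ?_
      simp only [hf]
      by_cases he : e ∈ Q
      · simp [he, hQ e he, haQ e he]
      · simp [he]
    rw [this, ← Real.exp_sum]
    exact Real.exp_le_exp.2 ht
  · have h2 : ∀ e, p * f e true + (1 - p) * f e false ≤
        (if e ∈ Q then p else 1) * Real.exp (p * (a e + a e ^ 2)) := by
      intro e
      simp only [hf]
      by_cases he : e ∈ Q
      · simp [he, haQ e he]
      · simp only [he, if_false, if_true, mul_one, one_mul]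
        have h3 := exp_quad (ha e)
        have h4 := Real.add_one_le_exp (p * (a e + a e ^ 2))
        have h5 : p * Real.exp (a e) ≤ p * (1 + a e + a e ^ 2) := by gcongr
        simp
        linarith
    have h3 : ∏ e, (p * f e true + (1 - p) * f e false) ≤
        ∏ e, (if e ∈ Q then p else 1) * Real.exp (p * (a e + a e ^ 2)) := by
      refine prod_le_prod (fun e _ => ?_) (fun e _ => h2 e)
      have := hf0 e true; have := hf0 e false
      have : 0 ≤ 1 - p := by linarith
      positivity
    rw [prod_mul_distrib, ← Real.exp_sum, ← mul_sum] at h3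
    have h4 : ∏ e : Sym2 (Fin n), (if e ∈ Q then p else 1) = p ^ Q.card := by
      rw [prod_ite_mem, univ_inter, prod_const]
    rw [h4] at h3
    calc _ ≤ (Real.exp t)⁻¹ * (p ^ Q.card * Real.exp (p * ∑ e, (a e + a e ^ 2))) := by gcongr
      _ = _ := by rw [← Real.exp_neg, Real.exp_add]; ring

/-- multiplicity of an edge between `B` and `Y` -/
noncomputable def mult {n : ℕ} (B Y : Finset (Fin n)) (e : Sym2 (Fin n)) : ℝ :=
  (((B ×ˢ Y).filter (fun z => z.1 ≠ z.2 ∧ s(z.1, z.2) = e)).card : ℝ)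

lemma mult_nonneg {n : ℕ} (B Y : Finset (Fin n)) (e : Sym2 (Fin n)) : 0 ≤ mult B Y e := by
  unfold mult; positivity

lemma mult_le {n : ℕ} (B Y : Finset (Fin n)) (e : Sym2 (Fin n)) : mult B Y e ≤ 2 := by
  unfold mult
  induction e using Sym2.ind with
  | _ a b =>
    have h1 : ((B ×ˢ Y).filter (fun z => z.1 ≠ z.2 ∧ s(z.1, z.2) = s(a, b))) ⊆ {(a, b), (b, a)} := by
      rintro ⟨x, y⟩ hz
      rw [mem_filter] at hz
      have := hz.2.2
      simp only [Sym2.eq_iff] at this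
      simp only [mem_insert, mem_singleton, Prod.mk.injEq]
      exact this
    have := (card_le_card h1).trans card_le_two
    exact_mod_cast this

/-- edge count between `B` and `Y` -/
noncomputable def ecount {n : ℕ} (B Y : Finset (Fin n)) (ω : Sym2 (Fin n) → Bool) : ℝ :=
  ∑ x ∈ B, ((nb (graphOf ω) x ∩ Y).card : ℝ)

lemma adj_iff {n : ℕ} (ω : Sym2 (Fin n) → Bool) (x y : Fin n) :
    (graphOf ω).Adj x y ↔ x ≠ y ∧ ω s(x, y) = true := by
  unfold graphOf
  rw [SimpleGraph.fromRel_adj, Sym2.eq_swap (a := y)]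
  simp

lemma sum_mult {n : ℕ} (B Y : Finset (Fin n)) (φ : Sym2 (Fin n) → ℝ) :
    ∑ e, mult B Y e * φ e = ∑ x ∈ B, ∑ y ∈ Y, if x ≠ y then φ s(x, y) else 0 := by
  unfold mult
  simp_rw [← sum_boole, sum_mul]
  rw [sum_comm, sum_product]
  refine sum_congr rfl fun x _ => sum_congr rfl fun y _ => ?_
  by_cases h : x = y
  · simp [h]
  · simp [h]

lemma ecount_eq {n : ℕ} (B Y : Finset (Fin n)) (ω : Sym2 (Fin n) → Bool) :
    ecount B Y ω = ∑ e, mult B Y e * (if ω e = true then 1 else 0) := by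
  rw [sum_mult, ecount]
  refine sum_congr rfl fun x _ => ?_
  have : nb (graphOf ω) x ∩ Y = Y.filter (fun y => x ≠ y ∧ ω s(x, y) = true) := by
    ext y; simp [mem_nb, adj_iff, and_comm]
  rw [this, ← sum_boole]
  refine sum_congr rfl fun y _ => ?_
  by_cases h : x = y <;> simp [h]

lemma sum_mult_le {n : ℕ} (B Y : Finset (Fin n)) : ∑ e, mult B Y e ≤ B.card * Y.card := by
  have := sum_mult B Y (fun _ => 1)
  simp only [mul_one] at this
  rw [this]
  calc _ ≤ ∑ x ∈ B, ∑ y ∈ Y, (1:ℝ) := by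
        refine sum_le_sum fun x _ => sum_le_sum fun y _ => ?_
        split_ifs <;> norm_num
    _ = _ := by simp

lemma sum_mult_ge {n : ℕ} (B Y : Finset (Fin n)) :
    (B.card * Y.card : ℝ) - B.card ≤ ∑ e, mult B Y e := by
  have := sum_mult B Y (fun _ => 1)
  simp only [mul_one] at this
  rw [this]
  calc (B.card * Y.card : ℝ) - B.card = ∑ x ∈ B, ((Y.card : ℝ) - 1) := by
        rw [sum_const, nsmul_eq_mul]; ring
    _ ≤ _ := by
      refine sum_le_sum fun x _ => ?_
      have h1 : ∑ y ∈ Y, (if x ≠ y then (1:ℝ) else 0) = ∑ y ∈ Y, (1 - if x = y then (1:ℝ) else 0) := by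
        refine sum_congr rfl fun y _ => ?_
        by_cases h : x = y <;> simp [h]
      rw [h1, sum_sub_distrib]
      have : ∑ y ∈ Y, (if x = y then (1:ℝ) else 0) ≤ 1 := by
        rw [sum_ite_eq]; split_ifs <;> norm_num
      simp only [sum_const, nsmul_eq_mul, mul_one]
      linarith

lemma edge_tail {n : ℕ} {p : ℝ} (h0 : 0 ≤ p) (h1 : p ≤ 1) (Q : Finset (Sym2 (Fin n)))
    (B Y : Finset (Fin n)) (hQ : ∀ x ∈ B, ∀ y ∈ Y, s(x, y) ∉ Q) (d l : ℝ)
    (hl0 : 0 ≤ l) (hl : l ≤ 1 / 2) :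
    (gnp n p).real {ω | (∀ e ∈ Q, ω e = true) ∧ d ≤ |ecount B Y ω - p * (B.card * Y.card)|} ≤
      2 * (p ^ Q.card * Real.exp (-l * d + l * p * B.card + 2 * l ^ 2 * p * (B.card * Y.card))) := by
  have hm0 : ∀ e ∈ Q, mult B Y e = 0 := by
    intro e he
    unfold mult
    rw [Nat.cast_eq_zero, card_eq_zero, filter_eq_empty_iff]
    rintro ⟨x, y⟩ hz ⟨_, h⟩
    rw [mem_product] at hz
    exact hQ x hz.1 y hz.2 (h ▸ he)
  have hM := sum_mult_le B Y
  have hM' := sum_mult_ge B Y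
  have hM2 : ∑ e, mult B Y e ^ 2 ≤ 2 * (B.card * Y.card) := by
    calc _ ≤ ∑ e, 2 * mult B Y e := by
          refine sum_le_sum fun e _ => ?_
          nlinarith [mult_le B Y e, mult_nonneg B Y e]
      _ = 2 * ∑ e, mult B Y e := by rw [mul_sum]
      _ ≤ _ := by gcongr
  set N : ℝ := (B.card * Y.card : ℝ) with hN
  have hp := gnp_prob (n := n) h0 h1
  have key : ∀ c : ℝ, |c| = l → ∀ t : ℝ, -t + p * (c * ∑ e, mult B Y e) ≤ -l * d + l * p * B.card →
      (gnp n p).real {ω | (∀ e ∈ Q, ω e = true) ∧ t ≤ c * ecount B Y ω} ≤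
      p ^ Q.card * Real.exp (-l * d + l * p * B.card + 2 * l ^ 2 * p * N) := by
    intro c hc t ht
    have h3 := chern h0 h1 Q (fun e => c * mult B Y e) (fun e => by
      rw [abs_mul, hc, abs_of_nonneg (mult_nonneg B Y e)]
      nlinarith [mult_le B Y e, mult_nonneg B Y e]) (fun e he => by simp [hm0 e he]) t
    have h4 : ∀ ω, ∑ e, c * mult B Y e * (if ω e = true then 1 else 0) = c * ecount B Y ω := by
      intro ω; rw [ecount_eq, mul_sum]; simp_rw [mul_assoc]
    simp_rw [h4] at h3
    refine h3.trans (mul_le_mul_of_nonneg_left (Real.exp_le_exp.2 ?_) (by positivity))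
    have h5 : ∑ e, (c * mult B Y e + (c * mult B Y e) ^ 2) =
        c * ∑ e, mult B Y e + l ^ 2 * ∑ e, mult B Y e ^ 2 := by
      rw [← hc, sq_abs, sum_add_distrib, mul_sum, mul_sum]
      congr 1
      exact sum_congr rfl fun e _ => by ring
    rw [h5, mul_add]
    have h6 : p * (l ^ 2 * ∑ e, mult B Y e ^ 2) ≤ p * (l ^ 2 * (2 * N)) := by gcongr
    linarith
  have hlp : 0 ≤ l * p := by positivity
  have k1 := key l (abs_of_nonneg hl0) (l * (p * N + d)) (by
    have : l * p * ∑ e, mult B Y e ≤ l * p * N := by gcongr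
    have : 0 ≤ l * p * B.card := by positivity
    linarith)
  have k2 := key (-l) (by rw [abs_neg, abs_of_nonneg hl0]) (-l * (p * N - d)) (by
    have : l * p * (N - B.card) ≤ l * p * ∑ e, mult B Y e := by gcongr
    linarith)
  rw [two_mul]
  refine le_trans ?_ (add_le_add k1 k2)
  refine le_trans (measureReal_mono ?_) (measureReal_union_le _ _)
  rintro ω ⟨hω, hd⟩
  rcases le_abs.1 hd with h | h
  · left
    exact ⟨hω, mul_le_mul_of_nonneg_left (by linarith) hl0⟩
  · right
    refine ⟨hω, ?_⟩
    nlinarith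

end BLS

namespace BLS
open Finset
open scoped Classical

lemma ub {n : ℕ} {p : ℝ} (h0 : 0 ≤ p) (h1 : p ≤ 1) {ι : Type*} (s : Finset ι)
    (S : Set (Sym2 (Fin n) → Bool)) (f : ι → Set (Sym2 (Fin n) → Bool)) (b : ι → ℝ)
    (hS : ∀ ω ∈ S, ∃ i ∈ s, ω ∈ f i) (hb : ∀ i ∈ s, (gnp n p).real (f i) ≤ b i) :
    (gnp n p).real S ≤ ∑ i ∈ s, b i := by
  have hp := gnp_prob (n := n) h0 h1
  refine le_trans (measureReal_mono ?_ (measure_ne_top _ _)) ((measureReal_biUnion_finset_le s f).trans (sum_le_sum hb))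
  intro ω hω
  simpa using hS ω hω

lemma dev {α : Type*} (X : Finset α) (d : α → ℝ) (c η T : ℝ)
    (h : T < ((X.filter (fun x => ¬ |d x - c| ≤ η)).card : ℝ)) :
    ∃ B ⊆ X, T / 2 ≤ (B.card : ℝ) ∧ η * B.card ≤ |∑ x ∈ B, d x - B.card * c| := by
  set B1 := X.filter (fun x => η < d x - c) with hB1
  set B2 := X.filter (fun x => η < -(d x - c)) with hB2
  have h1 : X.filter (fun x => ¬ |d x - c| ≤ η) ⊆ B1 ∪ B2 := by
    intro x hx
    rw [mem_filter, not_le, lt_abs] at hx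
    rw [mem_union, hB1, hB2, mem_filter, mem_filter]
    tauto
  have h2 : ((X.filter (fun x => ¬ |d x - c| ≤ η)).card : ℝ) ≤ B1.card + B2.card := by
    exact_mod_cast (card_le_card h1).trans (card_union_le _ _)
  rcases le_total (T / 2) (B1.card : ℝ) with h3 | h3
  · refine ⟨B1, filter_subset _ _, h3, le_trans ?_ (le_abs_self _)⟩
    calc η * B1.card = ∑ x ∈ B1, η := by rw [sum_const, nsmul_eq_mul]; ring
      _ ≤ ∑ x ∈ B1, (d x - c) := sum_le_sum fun x hx => by
          rw [hB1, mem_filter] at hx; exact hx.2.le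
      _ = _ := by rw [sum_sub_distrib, sum_const, nsmul_eq_mul]
  · refine ⟨B2, filter_subset _ _, by linarith, le_trans ?_ (neg_le_abs _)⟩
    calc η * B2.card = ∑ x ∈ B2, η := by rw [sum_const, nsmul_eq_mul]; ring
      _ ≤ ∑ x ∈ B2, -(d x - c) := sum_le_sum fun x hx => by
          rw [hB2, mem_filter] at hx; exact hx.2.le
      _ = _ := by rw [sum_neg_distrib, sum_sub_distrib, sum_const, nsmul_eq_mul]

section
variable {n : ℕ} {p ε K : ℝ}

lemma bad0 (h0 : 0 < p) (h1 : p ≤ 1) (he : 0 < ε) (he1 : ε ≤ 1) :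
    (gnp n p).real {ω | ∃ v, ¬ |((nb (graphOf ω) v).card : ℝ) - n * p| ≤ ε * (n * p)} ≤
      n * (2 * Real.exp (1 - ε ^ 2 * (n * p) / 8)) := by
  have := ub (n := n) h0.le h1 univ
    {ω | ∃ v, ¬ |((nb (graphOf ω) v).card : ℝ) - n * p| ≤ ε * (n * p)}
    (fun v => {ω | (∀ e ∈ (∅ : Finset (Sym2 (Fin n))), ω e = true) ∧
      ε * (n * p) ≤ |ecount {v} univ ω - p * (({v} : Finset (Fin n)).card * (univ : Finset (Fin n)).card)|})
    (fun _ => 2 * Real.exp (1 - ε ^ 2 * (n * p) / 8)) (by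
      rintro ω ⟨v, hv⟩
      refine ⟨v, mem_univ _, by simp, ?_⟩
      rw [not_le] at hv
      simp only [ecount, sum_singleton, card_singleton, inter_univ, card_univ, Fintype.card_fin,
        Nat.cast_one, one_mul]
      rw [mul_comm p]
      exact hv.le) (by
      intro v _
      refine (edge_tail h0.le h1 ∅ {v} univ (by simp) _ (ε / 4) (by positivity) (by linarith)).trans ?_
      simp only [card_empty, pow_zero, one_mul, card_singleton, card_univ, Fintype.card_fin,
        Nat.cast_one, mul_one]
      gcongr
      have : ε / 4 * p ≤ 1 := by nlinarith
      nlinarith)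
  simpa using this

lemma bad1 (h0 : 0 < p) (h1 : p ≤ 1) (he : 0 < ε) (he1 : ε ≤ 1) (hK : 384 ≤ K * ε ^ 2)
    (hn : 4 ≤ ε * (n * p)) :
    (gnp n p).real {ω | ∃ Y : Finset (Fin n), K / p < ((univ.filter (fun x =>
      ¬ |((nb (graphOf ω) x ∩ Y).card : ℝ) - p * Y.card| ≤ ε * (n * p))).card : ℝ)} ≤
      2 * Real.exp (-n) := by
  have := ub (n := n) h0.le h1
    ((univ : Finset (Finset (Fin n) × Finset (Fin n))).filter (fun z => K / p / 2 ≤ (z.1.card : ℝ)))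
    {ω | ∃ Y : Finset (Fin n), K / p < ((univ.filter (fun x =>
      ¬ |((nb (graphOf ω) x ∩ Y).card : ℝ) - p * Y.card| ≤ ε * (n * p))).card : ℝ)}
    (fun z => {ω | (∀ e ∈ (∅ : Finset (Sym2 (Fin n))), ω e = true) ∧
      ε * (n * p) * z.1.card ≤ |ecount z.1 z.2 ω - p * (z.1.card * z.2.card)|})
    (fun _ => 2 * Real.exp (-3 * n)) (by
      rintro ω ⟨Y, hY⟩
      obtain ⟨B, -, hB, hd⟩ := dev _ _ _ _ _ hY
      refine ⟨(B, Y), by simp only [mem_filter, mem_univ, true_and]; exact hB, by simp, ?_⟩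
      rw [show p * ((B.card : ℝ) * Y.card) = B.card * (p * Y.card) by ring]
      exact hd) (by
      rintro ⟨B, Y⟩ hz
      simp only [mem_filter, mem_univ, true_and] at hz
      refine (edge_tail h0.le h1 ∅ B Y (by simp) _ (ε / 4) (by positivity) (by linarith)).trans ?_
      simp only [card_empty, pow_zero, one_mul]
      gcongr
      have hY : (Y.card : ℝ) ≤ n := by exact_mod_cast (card_le_univ Y).trans (by simp)
      rw [div_div, div_le_iff₀ (by positivity)] at hz
      have hb : 0 ≤ (B.card : ℝ) := by positivity
      have e1 : 2 * (ε / 4) ^ 2 * p * (B.card * Y.card) ≤ 2 * (ε / 4) ^ 2 * p * (B.card * n) := by gcongr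
      have e2 : (ε / 16 * p * B.card) * 4 ≤ (ε / 16 * p * B.card) * (ε * (n * p)) := by gcongr
      have e3 : (ε / 16 * p * B.card) * (ε * (n * p)) ≤ (ε / 16 * p * B.card) * (ε * n) := by
        gcongr; nlinarith
      have e4 : K * (ε ^ 2 * n) ≤ B.card * (p * 2) * (ε ^ 2 * n) := by gcongr
      have e5 : 384 * (n:ℝ) ≤ K * ε ^ 2 * n := by gcongr
      linarith)
  refine this.trans ?_
  rw [sum_const, nsmul_eq_mul]
  have h2 : ((((univ : Finset (Finset (Fin n) × Finset (Fin n))).filter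
      (fun z => K / p / 2 ≤ (z.1.card : ℝ))).card : ℕ) : ℝ) ≤ Real.exp (2 * n) := by
    have h3 : ((univ : Finset (Finset (Fin n) × Finset (Fin n))).filter
      (fun z => K / p / 2 ≤ (z.1.card : ℝ))).card ≤ 4 ^ n := by
      refine (card_filter_le _ _).trans ?_
      simp [Fintype.card_prod, ← mul_pow]
    have h4 : (4:ℝ) ≤ Real.exp 2 := by
      have := Real.add_one_le_exp (1:ℝ)
      rw [show (2:ℝ) = 1 + 1 by norm_num, Real.exp_add]; nlinarith
    calc _ ≤ ((4 ^ n : ℕ) : ℝ) := by exact_mod_cast h3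
      _ = 4 ^ n := by push_cast; ring
      _ ≤ (Real.exp 2) ^ n := by gcongr
      _ = _ := by rw [← Real.exp_nat_mul]; ring_nf
  calc _ ≤ Real.exp (2 * n) * (2 * Real.exp (-3 * n)) := by gcongr
    _ = 2 * Real.exp (2 * n + -3 * n) := by rw [Real.exp_add]; ring
    _ = _ := by ring_nf

/-- the star with centre `x` and leaf set `N` -/
noncomputable def star (x : Fin n) (N : Finset (Fin n)) : Finset (Sym2 (Fin n)) :=
  N.image (fun w => s(x, w))

lemma star_card (x : Fin n) (N : Finset (Fin n)) : (star x N).card = N.card := by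
  unfold star
  refine card_image_of_injective _ fun a b h => ?_
  simp only [Sym2.eq_iff] at h
  rcases h with h | h
  · exact h.2
  · exact h.2.trans h.1

lemma sum_subsets (w : ℝ) : ∑ N : Finset (Fin n), w ^ N.card = (1 + w) ^ n := by
  have := Fintype.sum_pow_mul_eq_add_pow (Fin n) w 1
  simp only [one_pow, mul_one, Fintype.card_fin] at this
  rw [this, add_comm]

lemma one_add_pow_le {w : ℝ} (hw : 0 ≤ w) : (1 + w) ^ n ≤ Real.exp (n * w) := by
  rw [Real.exp_nat_mul]
  have := Real.add_one_le_exp w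
  gcongr
  linarith

lemma bad2' (h0 : 0 < p) (h1 : p ≤ 1) (he : 0 < ε) (he1 : ε ≤ 1) (hK : 384 ≤ K * ε ^ 2)
    (hn : 4 ≤ ε * (n * p)) :
    (gnp n p).real {ω | (∀ v, ((nb (graphOf ω) v).card : ℝ) ≤ 2 * (n * p)) ∧
      ∃ x, ∃ A ⊆ nb (graphOf ω) x, K / p < (((nb (graphOf ω) x).filter (fun b =>
      ¬ |((nb (graphOf ω) b ∩ A).card : ℝ) - p * A.card| ≤ ε * (n * p ^ 2))).card : ℝ)} ≤
      n * (2 * Real.exp (-2 * (n * p))) := by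
  -- fixed vertex, neighbourhood and pair of subsets
  have step1 : ∀ (x : Fin n) (N A B : Finset (Fin n)), x ∉ N → (N.card : ℝ) ≤ 2 * (n * p) → A ⊆ N →
      B ⊆ N → K / p / 2 ≤ (B.card : ℝ) →
      (gnp n p).real {ω | (∀ e ∈ star x N, ω e = true) ∧
        ε * (n * p ^ 2) * B.card ≤ |ecount B A ω - p * (B.card * A.card)|} ≤
        2 * (p ^ N.card * Real.exp (-6 * (n * p))) := by
    intro x N A B hx hN hA hB hz
    refine (edge_tail h0.le h1 (star x N) B A (fun b hb a ha hQ => ?_) _ (ε / 8) (by positivity)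
      (by linarith)).trans ?_
    · unfold star at hQ
      rw [mem_image] at hQ
      obtain ⟨w, hw, h⟩ := hQ
      rw [Sym2.eq_iff] at h
      rcases h with h | h
      · exact hx (h.1 ▸ hB hb)
      · exact hx (h.1 ▸ hA ha)
    rw [star_card]
    gcongr
    have hY : (A.card : ℝ) ≤ 2 * (n * p) := le_trans (by exact_mod_cast card_le_card hA) hN
    rw [div_div, div_le_iff₀ (by positivity)] at hz
    have hb : 0 ≤ (B.card : ℝ) := by positivity
    have e1 : 2 * (ε / 8) ^ 2 * p * (B.card * A.card) ≤ 2 * (ε / 8) ^ 2 * p * (B.card * (2 * (n * p))) := by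
      gcongr
    have e2 : (ε / 32 * p * B.card) * 4 ≤ (ε / 32 * p * B.card) * (ε * (n * p)) := by gcongr
    have e4 : K * (ε ^ 2 * (n * p)) ≤ B.card * (p * 2) * (ε ^ 2 * (n * p)) := by gcongr
    have e5 : 384 * ((n:ℝ) * p) ≤ K * ε ^ 2 * (n * p) := by gcongr
    linarith
  -- fixed vertex and neighbourhood
  have step2 : ∀ (x : Fin n) (N : Finset (Fin n)), x ∉ N → (N.card : ℝ) ≤ 2 * (n * p) →
      (gnp n p).real {ω | nb (graphOf ω) x = N ∧
      ∃ A ⊆ N, K / p < ((N.filter (fun b =>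
      ¬ |((nb (graphOf ω) b ∩ A).card : ℝ) - p * A.card| ≤ ε * (n * p ^ 2))).card : ℝ)} ≤
      (4 * p) ^ N.card * (2 * Real.exp (-6 * (n * p))) := by
    intro x N hx hN
    have := ub (n := n) h0.le h1
      ((N.powerset ×ˢ N.powerset).filter (fun z => K / p / 2 ≤ (z.1.card : ℝ)))
      {ω | nb (graphOf ω) x = N ∧
        ∃ A ⊆ N, K / p < ((N.filter (fun b =>
        ¬ |((nb (graphOf ω) b ∩ A).card : ℝ) - p * A.card| ≤ ε * (n * p ^ 2))).card : ℝ)}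
      (fun z => {ω | (∀ e ∈ star x N, ω e = true) ∧
        ε * (n * p ^ 2) * z.1.card ≤ |ecount z.1 z.2 ω - p * (z.1.card * z.2.card)|})
      (fun _ => 2 * (p ^ N.card * Real.exp (-6 * (n * p)))) (by
        rintro ω ⟨hNω, A, hA, hY⟩
        obtain ⟨B, hBN, hB, hd⟩ := dev _ _ _ _ _ hY
        refine ⟨(B, A), by simp only [mem_filter, mem_product, mem_powerset]; exact ⟨⟨hBN, hA⟩, hB⟩, ?_, ?_⟩
        · intro e he
          unfold star at he
          rw [mem_image] at he
          obtain ⟨w, hw, rfl⟩ := he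
          rw [← hNω, mem_nb, adj_iff] at hw
          exact hw.2
        · rw [show p * ((B.card : ℝ) * A.card) = B.card * (p * A.card) by ring]
          exact hd) (by
        rintro ⟨B, A⟩ hz
        simp only [mem_filter, mem_product, mem_powerset] at hz
        exact step1 x N A B hx hN hz.1.2 hz.1.1 hz.2)
    refine this.trans ?_
    rw [sum_const, nsmul_eq_mul]
    have h3 : ((N.powerset ×ˢ N.powerset).filter (fun z => K / p / 2 ≤ (z.1.card : ℝ))).card ≤
        4 ^ N.card := by
      refine (card_filter_le _ _).trans ?_
      simp [card_product, ← mul_pow]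
    have h4 : (((N.powerset ×ˢ N.powerset).filter (fun z => K / p / 2 ≤ (z.1.card : ℝ))).card : ℝ) ≤
        4 ^ N.card := by exact_mod_cast h3
    calc _ ≤ (4:ℝ) ^ N.card * (2 * (p ^ N.card * Real.exp (-6 * (n * p)))) := by gcongr
      _ = _ := by rw [mul_pow]; ring
  have step3 : ∀ x : Fin n, (gnp n p).real {ω | ((nb (graphOf ω) x).card : ℝ) ≤ 2 * (n * p) ∧
      ∃ A ⊆ nb (graphOf ω) x, K / p < (((nb (graphOf ω) x).filter (fun b =>
      ¬ |((nb (graphOf ω) b ∩ A).card : ℝ) - p * A.card| ≤ ε * (n * p ^ 2))).card : ℝ)} ≤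
      2 * Real.exp (-2 * (n * p)) := by
    intro x
    have := ub (n := n) h0.le h1
      ((univ : Finset (Finset (Fin n))).filter (fun N => x ∉ N ∧ (N.card : ℝ) ≤ 2 * (n * p)))
      {ω | ((nb (graphOf ω) x).card : ℝ) ≤ 2 * (n * p) ∧
        ∃ A ⊆ nb (graphOf ω) x, K / p < (((nb (graphOf ω) x).filter (fun b =>
        ¬ |((nb (graphOf ω) b ∩ A).card : ℝ) - p * A.card| ≤ ε * (n * p ^ 2))).card : ℝ)}
      (fun N => {ω | nb (graphOf ω) x = N ∧
        ∃ A ⊆ N, K / p < ((N.filter (fun b =>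
        ¬ |((nb (graphOf ω) b ∩ A).card : ℝ) - p * A.card| ≤ ε * (n * p ^ 2))).card : ℝ)})
      (fun N => (4 * p) ^ N.card * (2 * Real.exp (-6 * (n * p)))) (by
        rintro ω ⟨hd, hA⟩
        refine ⟨nb (graphOf ω) x, ?_, rfl, hA⟩
        simp only [mem_filter, mem_univ, true_and]
        refine ⟨?_, hd⟩
        rw [mem_nb]
        exact (graphOf ω).loopless.irrefl x) (by
        intro N hN
        simp only [mem_filter, mem_univ, true_and] at hN
        exact step2 x N hN.1 hN.2)
    refine this.trans ?_
    calc _ ≤ ∑ N : Finset (Fin n), (4 * p) ^ N.card * (2 * Real.exp (-6 * (n * p))) :=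
          sum_le_sum_of_subset_of_nonneg (filter_subset _ _) (fun _ _ _ => by positivity)
      _ = (1 + 4 * p) ^ n * (2 * Real.exp (-6 * (n * p))) := by rw [← sum_mul, sum_subsets]
      _ ≤ Real.exp (n * (4 * p)) * (2 * Real.exp (-6 * (n * p))) := by
          gcongr; exact one_add_pow_le (by positivity)
      _ = 2 * Real.exp (n * (4 * p) + -6 * (n * p)) := by rw [Real.exp_add]; ring
      _ = _ := by ring_nf
  have := ub (n := n) h0.le h1 univ
    {ω | (∀ v, ((nb (graphOf ω) v).card : ℝ) ≤ 2 * (n * p)) ∧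
      ∃ x, ∃ A ⊆ nb (graphOf ω) x, K / p < (((nb (graphOf ω) x).filter (fun b =>
      ¬ |((nb (graphOf ω) b ∩ A).card : ℝ) - p * A.card| ≤ ε * (n * p ^ 2))).card : ℝ)}
    (fun x => {ω | ((nb (graphOf ω) x).card : ℝ) ≤ 2 * (n * p) ∧
      ∃ A ⊆ nb (graphOf ω) x, K / p < (((nb (graphOf ω) x).filter (fun b =>
      ¬ |((nb (graphOf ω) b ∩ A).card : ℝ) - p * A.card| ≤ ε * (n * p ^ 2))).card : ℝ)})
    (fun _ => 2 * Real.exp (-2 * (n * p)))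
    (by
      rintro ω ⟨hd, x, hx⟩
      exact ⟨x, mem_univ _, hd x, hx⟩) (fun x _ => step3 x)
  simpa using this

lemma bad3 (h0 : 0 < p) (h1 : p ≤ 1) :
    (gnp n p).real {ω | ∃ x y, x ≠ y ∧ 8 * (n * p ^ 2) <
      ((nb (graphOf ω) x ∩ nb (graphOf ω) y).card : ℝ)} ≤
      n ^ 2 * Real.exp (-5 * (n * p ^ 2)) := by
  have step1 : ∀ x y : Fin n, x ≠ y → ∀ S : Finset (Fin n), x ∉ S → y ∉ S →
      (gnp n p).real {ω | ∀ e ∈ star x S ∪ star y S, ω e = true} ≤ (p ^ 2) ^ S.card := by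
    intro x y hxy S hx hy
    have h2 := chern (n := n) h0.le h1 (star x S ∪ star y S) (fun _ => 0) (by simp) (by simp) 0
    simp only [zero_mul, sum_const_zero, le_refl, and_true, neg_zero, ne_eq, OfNat.ofNat_ne_zero,
      not_false_eq_true, zero_pow, add_zero, mul_zero, Real.exp_zero, mul_one] at h2
    refine h2.trans (le_of_eq ?_)
    rw [card_union_of_disjoint, star_card, star_card, ← pow_mul]
    · congr 1; ring
    · rw [disjoint_left]
      intro e he he'
      unfold star at he he'
      rw [mem_image] at he he'
      obtain ⟨w, hw, rfl⟩ := he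
      obtain ⟨w', hw', h⟩ := he'
      rw [Sym2.eq_iff] at h
      rcases h with h | h
      · exact hxy h.1.symm
      · exact hx (h.2 ▸ hw')
  have step2 : ∀ x y : Fin n, x ≠ y → (gnp n p).real {ω | 8 * (n * p ^ 2) <
      ((nb (graphOf ω) x ∩ nb (graphOf ω) y).card : ℝ)} ≤ Real.exp (-5 * (n * p ^ 2)) := by
    intro x y hxy
    have := ub (n := n) h0.le h1
      ((univ : Finset (Finset (Fin n))).filter (fun S => (x ∉ S ∧ y ∉ S) ∧ 8 * (n * p ^ 2) < (S.card : ℝ)))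
      {ω | 8 * (n * p ^ 2) < ((nb (graphOf ω) x ∩ nb (graphOf ω) y).card : ℝ)}
      (fun S => {ω | ∀ e ∈ star x S ∪ star y S, ω e = true})
      (fun S => (3 * p ^ 2) ^ S.card * Real.exp (-8 * (n * p ^ 2))) (by
        intro ω hω
        refine ⟨nb (graphOf ω) x ∩ nb (graphOf ω) y, ?_, ?_⟩
        · simp only [mem_filter, mem_univ, true_and, mem_inter, mem_nb]
          exact ⟨⟨fun h => (graphOf ω).loopless.irrefl x h.1, fun h => (graphOf ω).loopless.irrefl y h.2⟩, hω⟩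
        · intro e he
          unfold star at he
          rw [mem_union, mem_image, mem_image] at he
          rcases he with ⟨w, hw, rfl⟩ | ⟨w, hw, rfl⟩
          · rw [mem_inter, mem_nb, mem_nb, adj_iff, adj_iff] at hw
            exact hw.1.2
          · rw [mem_inter, mem_nb, mem_nb, adj_iff, adj_iff] at hw
            exact hw.2.2) (by
        intro S hS
        simp only [mem_filter, mem_univ, true_and] at hS
        refine (step1 x y hxy S hS.1.1 hS.1.2).trans ?_
        rw [mul_pow]
        have h3 : 1 ≤ (3:ℝ) ^ S.card * Real.exp (-8 * (n * p ^ 2)) := by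
          have h4 : Real.exp S.card ≤ 3 ^ S.card := by
            have : Real.exp (S.card : ℝ) = (Real.exp 1) ^ S.card := by rw [← Real.exp_nat_mul, mul_one]
            rw [this]
            gcongr
            exact Real.exp_one_lt_three.le
          calc (1:ℝ) = Real.exp 0 := by simp
            _ ≤ Real.exp (S.card + -8 * (n * p ^ 2)) := Real.exp_le_exp.2 (by linarith)
            _ = Real.exp S.card * Real.exp (-8 * (n * p ^ 2)) := Real.exp_add _ _
            _ ≤ _ := by gcongr
        have h5 : 0 ≤ (p ^ 2) ^ S.card := by positivity
        calc (p ^ 2) ^ S.card = (p ^ 2) ^ S.card * 1 := by ring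
          _ ≤ (p ^ 2) ^ S.card * (3 ^ S.card * Real.exp (-8 * (n * p ^ 2))) := by gcongr
          _ = _ := by ring)
    refine this.trans ?_
    calc _ ≤ ∑ S : Finset (Fin n), (3 * p ^ 2) ^ S.card * Real.exp (-8 * (n * p ^ 2)) :=
          sum_le_sum_of_subset_of_nonneg (filter_subset _ _) (fun _ _ _ => by positivity)
      _ = (1 + 3 * p ^ 2) ^ n * Real.exp (-8 * (n * p ^ 2)) := by rw [← sum_mul, sum_subsets]
      _ ≤ Real.exp (n * (3 * p ^ 2)) * Real.exp (-8 * (n * p ^ 2)) := by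
          gcongr; exact one_add_pow_le (by positivity)
      _ = Real.exp (n * (3 * p ^ 2) + -8 * (n * p ^ 2)) := by rw [Real.exp_add]
      _ = _ := by ring_nf
  have := ub (n := n) h0.le h1
    ((univ : Finset (Fin n × Fin n)).filter (fun z => z.1 ≠ z.2))
    {ω | ∃ x y, x ≠ y ∧ 8 * (n * p ^ 2) <
      ((nb (graphOf ω) x ∩ nb (graphOf ω) y).card : ℝ)}
    (fun z => {ω | 8 * (n * p ^ 2) < ((nb (graphOf ω) z.1 ∩ nb (graphOf ω) z.2).card : ℝ)})
    (fun _ => Real.exp (-5 * (n * p ^ 2)))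
    (by
      rintro ω ⟨x, y, hxy, h⟩
      exact ⟨(x, y), by simpa using hxy, h⟩) (fun z hz => step2 z.1 z.2 (by simpa using hz))
  refine this.trans ?_
  rw [sum_const, nsmul_eq_mul]
  gcongr
  have h3 : ((univ : Finset (Fin n × Fin n)).filter (fun z => z.1 ≠ z.2)).card ≤ n ^ 2 := by
    refine (card_filter_le _ _).trans ?_
    simp [sq]
  exact_mod_cast h3

end
end BLS

namespace BLS
open Finset
open scoped Classical

lemma qr_prob {n : ℕ} {p ε K : ℝ} (h0 : 0 < p) (h1 : p ≤ 1) (he : 0 < ε) (he1 : ε ≤ 1)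
    (hK : 384 ≤ K * ε ^ 2) (hlog : 1 ≤ Real.log n)
    (hL : 16 / ε ^ 2 * Real.log n ≤ n * p ^ 2) :
    (gnp n p).real {ω | ¬ QR (graphOf ω) n p ε K} ≤ 11 / n := by
  have hprob := gnp_prob (n := n) h0.le h1
  have hn0 : (0:ℝ) < n := by
    rcases Nat.eq_zero_or_pos n with h | h
    · subst h; simp at hlog; linarith
    · exact_mod_cast h
  have hn1 : (1:ℝ) ≤ n := by
    have : 0 < n := by exact_mod_cast hn0
    exact_mod_cast this
  set L := Real.log n with hLdef
  have hexp : Real.exp (-L) = 1 / n := by rw [Real.exp_neg, hLdef, Real.exp_log hn0]; simp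
  have hLn : L ≤ n := by
    have := Real.log_le_sub_one_of_pos hn0; linarith
  have hnp : n * p ^ 2 ≤ n * p := by
    have : p ^ 2 ≤ p := by nlinarith
    gcongr
  have he2 : 1 ≤ 1 / ε ^ 2 := by
    rw [le_div_iff₀ (by positivity)]; nlinarith
  have hL16 : 16 * L ≤ n * p ^ 2 := by
    refine le_trans ?_ hL
    have : 16 * L * 1 ≤ 16 * L * (1 / ε ^ 2) := by gcongr
    calc _ = 16 * L * 1 := by ring
      _ ≤ _ := this
      _ = _ := by ring
  have hLe : 16 * L ≤ ε ^ 2 * (n * p ^ 2) := by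
    have : ε ^ 2 * (16 / ε ^ 2 * L) ≤ ε ^ 2 * (n * p ^ 2) := by gcongr
    have e : ε ^ 2 * (16 / ε ^ 2 * L) = 16 * L := by field_simp
    linarith
  have hnp4 : 4 ≤ ε * (n * p) := by
    have : ε ^ 2 * (n * p ^ 2) ≤ ε * (n * p) := by
      have : ε ^ 2 ≤ ε := by nlinarith
      gcongr
    linarith
  have b0 := bad0 (n := n) h0 h1 he he1
  have b1 := bad1 (n := n) h0 h1 he he1 hK hnp4
  have b2 := bad2' (n := n) h0 h1 he he1 hK hnp4
  have b3 := bad3 (n := n) h0 h1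
  set E0 := {ω : Sym2 (Fin n) → Bool | ∃ v, ¬ |((nb (graphOf ω) v).card : ℝ) - n * p| ≤ ε * (n * p)} with hE0
  set E1 := {ω : Sym2 (Fin n) → Bool | ∃ Y : Finset (Fin n), K / p < ((univ.filter (fun x =>
      ¬ |((nb (graphOf ω) x ∩ Y).card : ℝ) - p * Y.card| ≤ ε * (n * p))).card : ℝ)} with hE1
  set E2 := {ω : Sym2 (Fin n) → Bool | (∀ v, ((nb (graphOf ω) v).card : ℝ) ≤ 2 * (n * p)) ∧
      ∃ x, ∃ A ⊆ nb (graphOf ω) x, K / p < (((nb (graphOf ω) x).filter (fun b =>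
      ¬ |((nb (graphOf ω) b ∩ A).card : ℝ) - p * A.card| ≤ ε * (n * p ^ 2))).card : ℝ)} with hE2
  set E3 := {ω : Sym2 (Fin n) → Bool | ∃ x y, x ≠ y ∧ 8 * (n * p ^ 2) <
      ((nb (graphOf ω) x ∩ nb (graphOf ω) y).card : ℝ)} with hE3
  have hsub : {ω | ¬ QR (graphOf ω) n p ε K} ⊆ E0 ∪ (E1 ∪ (E2 ∪ E3)) := by
    intro ω hω
    by_contra hc
    simp only [Set.mem_union, not_or] at hc
    obtain ⟨c0, c1, c2, c3⟩ := hc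
    have d0 : ∀ v, |((nb (graphOf ω) v).card : ℝ) - n * p| ≤ ε * (n * p) := by
      by_contra hh; push Not at hh; obtain ⟨v, hv⟩ := hh; exact c0 ⟨v, not_le.2 hv⟩
    apply hω
    refine ⟨d0, ?_, ?_, ?_⟩
    · intro Y
      by_contra hh; exact c1 ⟨Y, lt_of_lt_of_eq (not_le.1 hh) (by congr!)⟩
    · intro x A hA
      by_contra hh
      refine c2 ⟨fun v => ?_, x, A, hA, lt_of_lt_of_eq (not_le.1 hh) (by congr!)⟩
      have := (abs_le.1 (d0 v)).2
      have : ε * (n * p) ≤ 1 * (n * p) := by gcongr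
      linarith
    · intro x y hxy
      by_contra hh; exact c3 ⟨x, y, hxy, lt_of_lt_of_eq (not_le.1 hh) (by congr!)⟩
  have hu : (gnp n p).real {ω | ¬ QR (graphOf ω) n p ε K} ≤
      (gnp n p).real E0 + ((gnp n p).real E1 + ((gnp n p).real E2 + (gnp n p).real E3)) := by
    refine (measureReal_mono hsub).trans ((measureReal_union_le _ _).trans ?_)
    gcongr
    refine (measureReal_union_le _ _).trans ?_
    gcongr
    exact measureReal_union_le _ _
  have ee : Real.exp (-2 * L) = 1 / n * (1 / n) := by
    rw [show -2 * L = -L + -L by ring, Real.exp_add, hexp]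
  have f0 : n * (2 * Real.exp (1 - ε ^ 2 * (n * p) / 8)) ≤ 6 / n := by
    have e1 : Real.exp (1 - ε ^ 2 * (n * p) / 8) ≤ Real.exp 1 * Real.exp (-2 * L) := by
      rw [← Real.exp_add]
      apply Real.exp_le_exp.2
      have : ε ^ 2 * (n * p ^ 2) ≤ ε ^ 2 * (n * p) := by gcongr
      linarith
    have e2 := Real.exp_one_lt_three.le
    calc _ ≤ n * (2 * (3 * Real.exp (-2 * L))) := by
          gcongr
          exact e1.trans (by gcongr)
      _ = _ := by rw [ee]; field_simp; ring
  have f1 : 2 * Real.exp (-n) ≤ 2 / (n:ℝ) := by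
    have : Real.exp (-n) ≤ Real.exp (-L) := Real.exp_le_exp.2 (by linarith)
    rw [hexp] at this
    calc _ ≤ 2 * (1 / (n:ℝ)) := by gcongr
      _ = _ := by ring
  have f2 : n * (2 * Real.exp (-2 * (n * p))) ≤ 2 / n := by
    have : Real.exp (-2 * (n * p)) ≤ Real.exp (-2 * L) := Real.exp_le_exp.2 (by linarith)
    calc _ ≤ n * (2 * Real.exp (-2 * L)) := by gcongr
      _ = _ := by rw [ee]; field_simp
  have f3 : n ^ 2 * Real.exp (-5 * (n * p ^ 2)) ≤ 1 / n := by
    have : Real.exp (-5 * (n * p ^ 2)) ≤ Real.exp (-2 * L + -L) := Real.exp_le_exp.2 (by linarith)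
    calc _ ≤ n ^ 2 * Real.exp (-2 * L + -L) := by gcongr
      _ = _ := by rw [Real.exp_add, ee, hexp]; field_simp
  have : 11 / (n:ℝ) = 6 / n + (2 / n + (2 / n + 1 / n)) := by ring
  rw [this]
  linarith

/-- turning a packing into a function -/
lemma pack_fun {n : ℕ} {G : SimpleGraph (Fin n)} {P : Finset (Fin n × Fin n × Fin n)} (hP : IsPack G P) :
    ∃ f : Fin P.card × Fin 3 → Fin n, Function.Injective f ∧
      ∀ (i : Fin P.card) (a b : Fin 3), a ≠ b → G.Adj (f (i, a)) (f (i, b)) := by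
  set T : Fin P.card → Fin n × Fin n × Fin n := fun i => (P.equivFin.symm i : Fin n × Fin n × Fin n) with hT
  have hTP : ∀ i, T i ∈ P := fun i => (P.equivFin.symm i).2
  have hTi : Function.Injective T := fun i j h => P.equivFin.symm.injective (Subtype.ext h)
  set f : Fin P.card × Fin 3 → Fin n := fun z => ![(T z.1).1, (T z.1).2.1, (T z.1).2.2] z.2 with hf
  have hadj : ∀ (i : Fin P.card) (a b : Fin 3), a ≠ b → G.Adj (f (i, a)) (f (i, b)) := by
    intro i a b hab
    have h := mem_tri.1 (hP.1 (hTP i))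
    fin_cases a <;> fin_cases b <;> simp_all [G.adj_comm]
  have hvs : ∀ i a, f (i, a) ∈ vs (T i) := by
    intro i a
    rw [mem_vs]
    fin_cases a <;> simp [hf]
  refine ⟨f, ?_, hadj⟩
  rintro ⟨i, a⟩ ⟨j, b⟩ h
  have hij : i = j := by
    by_contra hij
    have := hP.2 _ (hTP i) _ (hTP j) (fun h => hij (hTi h))
    exact disjoint_left.1 this (hvs i a) (h ▸ hvs j b)
  subst hij
  by_cases hab : a = b
  · rw [hab]
  · exact absurd h (hadj i a b hab).ne

lemma ncard_nb {n : ℕ} (G : SimpleGraph (Fin n)) (v : Fin n) :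
    (G.neighborSet v).ncard = (nb G v).card := by
  rw [← Set.ncard_coe_finset]
  congr 1
  ext w; simp [mem_nb]

lemma ncard_diff_nb {n : ℕ} (Γ G : SimpleGraph (Fin n)) (v : Fin n) :
    (Γ.neighborSet v \ G.neighborSet v).ncard = (nb Γ v \ nb G v).card := by
  rw [← Set.ncard_coe_finset]
  congr 1
  ext w; simp [mem_nb]

lemma mk_setup {n : ℕ} {Γ G : SimpleGraph (Fin n)} {p ε K g γ : ℝ} (hp : 0 < p) (hp1 : p ≤ 1)
    (he : 0 < ε) (heg : ε ≤ g / 10) (hg : 0 < g) (hg1 : g ≤ 1 / 6) (hgγ : 2 * g ≤ γ) (hK : 1 ≤ K)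
    (hbig : 1600 * K ≤ n * p ^ 2) (hqr : QR Γ n p ε K) (hsub : G ≤ Γ)
    (hdel : ∀ v : Fin n, ((Γ.neighborSet v \ G.neighborSet v).ncard : ℝ) ≤
            (1 / 3 - γ) * (Γ.neighborSet v).ncard) : Setup Γ G n p ε K g := by
  have hnp : 0 ≤ n * p := by positivity
  have hd : ∀ v, ((nb Γ v \ nb G v).card : ℝ) ≤ (1 / 3 - 2 * g) * (nb Γ v).card := by
    intro v
    have := hdel v
    rw [ncard_nb, ncard_diff_nb] at this
    have : (1 / 3 - γ) * ((nb Γ v).card : ℝ) ≤ (1 / 3 - 2 * g) * (nb Γ v).card := by gcongr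
    linarith
  refine ⟨by simp, hp, hp1, he, heg, hg, hg1, hK, hbig, hqr, hsub, ?_, ?_⟩
  · intro v
    have h1 := hd v
    have h2 := (abs_le.1 (hqr.deg v)).2
    have h3 : (1 / 3 - 2 * g) * ((nb Γ v).card : ℝ) ≤ (1 / 3 - 2 * g) * ((1 + ε) * (n * p)) := by
      have : 0 ≤ 1 / 3 - 2 * g := by linarith
      gcongr; linarith
    have h4 : (1 / 3 - 2 * g) * (1 + ε) ≤ 1 / 3 - g := by nlinarith
    have h5 : (1 / 3 - 2 * g) * (1 + ε) * (n * p) ≤ (1 / 3 - g) * (n * p) := by gcongr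
    have h6 : ((nb Γ v \ nb G v).card : ℝ) ≤ (1 / 3 - g) * (n * p) := by linarith
    convert h6
  · intro v
    have h1 := hd v
    have h2 := (abs_le.1 (hqr.deg v)).1
    have hs : nb G v ⊆ nb Γ v := fun w hw => mem_nb.2 (hsub (mem_nb.1 hw))
    have h0 : ((nb Γ v \ nb G v).card : ℝ) = (nb Γ v).card - (nb G v).card := cast_card_sdiff hs
    have h3 : (2 / 3 + 2 * g) * ((1 - ε) * (n * p)) ≤ (2 / 3 + 2 * g) * ((nb Γ v).card : ℝ) := by
      gcongr; linarith
    have h4 : 2 / 3 + g ≤ (2 / 3 + 2 * g) * (1 - ε) := by nlinarith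
    have h5 : (2 / 3 + g) * (n * p) ≤ (2 / 3 + 2 * g) * (1 - ε) * (n * p) := by gcongr
    linarith

theorem main (γ : ℝ) (hγ : 0 < γ) :
    ∃ C D : ℝ, 0 < C ∧ 0 < D ∧ ∀ p : ℕ → ℝ, (∀ n, 0 ≤ p n ∧ p n ≤ 1) →
      (∀ᶠ n : ℕ in atTop, C * (Real.log n / n) ^ ((1 : ℝ) / 2) ≤ p n) →
      Tendsto (fun n : ℕ => gnp n (p n)
        {ω | ∀ G : SimpleGraph (Fin n), G ≤ graphOf ω →
          (∀ v : Fin n, (((graphOf ω).neighborSet v \ G.neighborSet v).ncard : ℝ) ≤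
            (1 / 3 - γ) * ((graphOf ω).neighborSet v).ncard) →
          ∃ (k : ℕ) (f : Fin k × Fin 3 → Fin n), Function.Injective f ∧
            (∀ (i : Fin k) (a b : Fin 3), a ≠ b → G.Adj (f (i, a)) (f (i, b))) ∧
            (n : ℝ) - 3 * k ≤ D / p n ^ 2}) atTop (𝓝 1) := by
  obtain ⟨g, hg, hg1, hgγ⟩ : ∃ g : ℝ, 0 < g ∧ g ≤ 1 / 6 ∧ 2 * g ≤ γ := by
    refine ⟨min (γ / 2) (1 / 6), by positivity, min_le_right _ _, ?_⟩
    have := min_le_left (γ / 2) (1 / 6); linarith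
  obtain ⟨ε0, hε0⟩ : ∃ ε0, ε0 = g ^ 2 / 10 ^ 12 := ⟨_, rfl⟩
  have heps0p : 0 < ε0 := by rw [hε0]; positivity
  have hε01 : ε0 ≤ 1 := by rw [hε0]; nlinarith
  obtain ⟨σ, hσ⟩ : ∃ σ, σ = g ^ 2 * ε0 ^ 2 / 10000 := ⟨_, rfl⟩
  have hσp : 0 < σ := by rw [hσ]; positivity
  obtain ⟨δ, hδ⟩ : ∃ δ, δ = 64 * σ ^ 2 / (g ^ 2 * ε0) := ⟨_, rfl⟩
  have hδp : 0 < δ := by rw [hδ]; positivity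
  obtain ⟨ε, hε⟩ : ∃ ε, ε = ε0 * g / 64 := ⟨_, rfl⟩
  have hεp : 0 < ε := by rw [hε]; positivity
  have hεg : ε ≤ g / 10 := by rw [hε]; nlinarith
  have hε1 : ε ≤ 1 := by linarith
  obtain ⟨K, hK⟩ : ∃ K, K = 384 / ε ^ 2 := ⟨_, rfl⟩
  have hKe : K * ε ^ 2 = 384 := by rw [hK]; field_simp
  have hK1 : 1 ≤ K := by
    rw [hK, le_div_iff₀ (by positivity)]; nlinarith
  have hKp : 0 < K := by linarith
  obtain ⟨D, hD⟩ : ∃ D, D = 200 * K + 2 * K / ε := ⟨_, rfl⟩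
  have hDp : 0 < D := by rw [hD]; positivity
  have t1 : 0 ≤ 1600 * K := by positivity
  have t2 : 0 ≤ 512 * K / (g * ε0 ^ 2 * δ) := by positivity
  have t3 : 0 ≤ 216 / (ε0 ^ 2 * σ ^ 2) := by positivity
  have t4 : 0 ≤ 2 * K / σ ^ 2 := by positivity
  have t5 : 0 ≤ 8 * K / ε := by positivity
  have t6 : 0 ≤ 2 * K / ε0 := by positivity
  have t7 : 0 ≤ 4 * D / ε0 := by positivity
  have t8 : 0 < 16 / ε ^ 2 := by positivity
  have t9 : 0 ≤ 2 * K / ε := by positivity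
  obtain ⟨M, hM⟩ : ∃ M, M = 1600 * K + 512 * K / (g * ε0 ^ 2 * δ) + 216 / (ε0 ^ 2 * σ ^ 2) +
    2 * K / σ ^ 2 + 8 * K / ε + 2 * K / ε0 + 4 * D / ε0 + 16 / ε ^ 2 := ⟨_, rfl⟩
  have hMp : 0 < M := by rw [hM]; linarith
  refine ⟨Real.sqrt M, 6 * D, Real.sqrt_pos.2 hMp, by positivity, ?_⟩
  intro p hp01 hpC
  have hlogev : ∀ᶠ n : ℕ in atTop, 1 ≤ Real.log n :=
    (Real.tendsto_log_atTop.comp tendsto_natCast_atTop_atTop).eventually_ge_atTop 1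
  have hmain : ∀ᶠ n : ℕ in atTop, ENNReal.ofReal (1 - 11 / n) ≤ gnp n (p n)
        {ω | ∀ G : SimpleGraph (Fin n), G ≤ graphOf ω →
          (∀ v : Fin n, (((graphOf ω).neighborSet v \ G.neighborSet v).ncard : ℝ) ≤
            (1 / 3 - γ) * ((graphOf ω).neighborSet v).ncard) →
          ∃ (k : ℕ) (f : Fin k × Fin 3 → Fin n), Function.Injective f ∧
            (∀ (i : Fin k) (a b : Fin 3), a ≠ b → G.Adj (f (i, a)) (f (i, b))) ∧
            (n : ℝ) - 3 * k ≤ 6 * D / p n ^ 2} := by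
    filter_upwards [hpC, hlogev, eventually_gt_atTop 0] with n hn hlog hnpos
    have hn0 : (0:ℝ) < n := by exact_mod_cast hnpos
    have hp1 := (hp01 n).2
    generalize p n = q at hn hp1 ⊢
    have hLn : 0 < Real.log n / n := by positivity
    have hq : 0 < q := lt_of_lt_of_le (by positivity) hn
    have hq2 : M * Real.log n ≤ n * q ^ 2 := by
      have h1 : (Real.sqrt M * (Real.log n / n) ^ ((1 : ℝ) / 2)) ^ 2 ≤ q ^ 2 := by gcongr
      rw [mul_pow, Real.sq_sqrt hMp.le, ← Real.sqrt_eq_rpow, Real.sq_sqrt hLn.le] at h1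
      have h2 : n * (M * (Real.log n / n)) ≤ n * q ^ 2 := by gcongr
      have h3 : n * (M * (Real.log n / n)) = M * Real.log n := by field_simp
      linarith
    have hMn : M ≤ n * q ^ 2 := by nlinarith
    have hpart : ∀ x, x ≤ M → x * Real.log n ≤ n * q ^ 2 := fun x hx =>
      le_trans (by gcongr) hq2
    have hprob := gnp_prob (n := n) hq.le hp1
    have hQ := qr_prob (n := n) hq hp1 hεp hε1 hKe.ge hlog (hpart _ (by rw [hM]; linarith))
    have hdet : {ω | ¬ QR (graphOf ω) n q ε K}ᶜ ⊆ {ω | ∀ G : SimpleGraph (Fin n), G ≤ graphOf ω →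
          (∀ v : Fin n, (((graphOf ω).neighborSet v \ G.neighborSet v).ncard : ℝ) ≤
            (1 / 3 - γ) * ((graphOf ω).neighborSet v).ncard) →
          ∃ (k : ℕ) (f : Fin k × Fin 3 → Fin n), Function.Injective f ∧
            (∀ (i : Fin k) (a b : Fin 3), a ≠ b → G.Adj (f (i, a)) (f (i, b))) ∧
            (n : ℝ) - 3 * k ≤ 6 * D / q ^ 2} := by
      intro ω hω G hG hdel
      have hqr : QR (graphOf ω) n q ε K := by
        by_contra hh; exact hω hh
      have hS : Setup (graphOf ω) G n q ε K g := mk_setup hq hp1 hεp hεg hg hg1 hgγ hK1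
        (by linarith) hqr hG hdel
      have h4D := hpart (4 * D / ε0) (by rw [hM]; linarith)
      obtain ⟨P, hP, hPc⟩ := hS.conclude ε0 σ δ D hε0 hσ hδ hε.le (by linarith) (by linarith)
        (by linarith) (by linarith) (by linarith) (by linarith) (by linarith) hlog (by
          have : ε0 * (4 * D / ε0 * Real.log n) ≤ ε0 * (n * q ^ 2) := by gcongr
          have e : ε0 * (4 * D / ε0 * Real.log n) = 4 * D * Real.log n := by field_simp
          linarith)
      obtain ⟨f, hf, hadj⟩ := pack_fun hP
      refine ⟨P.card, f, hf, hadj, ?_⟩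
      have h9 : ((univ \ cover P).card : ℝ) = (univ : Finset (Fin n)).card - (cover P).card :=
        cast_card_sdiff (subset_univ (cover P))
      rw [cover_card hP] at h9
      simp only [card_univ, Fintype.card_fin] at h9
      push_cast at h9
      rw [← h9]
      convert hPc
    have h5 : (1:ℝ) - 11 / n ≤ (gnp n q).real {ω | ¬ QR (graphOf ω) n q ε K}ᶜ := by
      rw [probReal_compl_eq_one_sub (Set.toFinite _).measurableSet]
      linarith
    refine le_trans ?_ (measure_mono hdet)
    rw [← ofReal_measureReal]
    exact ENNReal.ofReal_le_ofReal h5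
  refine tendsto_of_tendsto_of_tendsto_of_le_of_le' ?_ tendsto_const_nhds hmain
    (Filter.Eventually.of_forall fun n => ?_)
  · have h1 : Tendsto (fun n : ℕ => (1:ℝ) - 11 / n) atTop (𝓝 (1 - 0)) :=
      tendsto_const_nhds.sub (tendsto_const_div_atTop_nhds_zero_nat 11)
    have := ENNReal.tendsto_ofReal h1
    simpa using this
  · have := gnp_prob (n := n) (hp01 n).1 (hp01 n).2
    exact prob_le_one

end BLS

/-- **Balogh–Lee–Samotij theorem (local resilience for almost spanning triangle factors).**
For every `γ > 0` there are constants `C` and `D` such that if `p ≥ C·(log n/n)^{1/2}` then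
a.a.s. every spanning subgraph of `G(n,p)` obtained by deleting at most `(1/3 - γ)·deg(v)`
edges at every vertex `v` contains a collection of pairwise vertex-disjoint triangles covering
all but at most `D·p⁻²` vertices. -/
theorem stmt_17 (γ : ℝ) (hγ : 0 < γ) :
    ∃ C D : ℝ, 0 < C ∧ 0 < D ∧ ∀ p : ℕ → ℝ, (∀ n, 0 ≤ p n ∧ p n ≤ 1) →
      (∀ᶠ n : ℕ in atTop, C * (Real.log n / n) ^ ((1 : ℝ) / 2) ≤ p n) →
      Tendsto (fun n : ℕ => gnp n (p n)
        {ω | ∀ G : SimpleGraph (Fin n), G ≤ graphOf ω →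
          (∀ v : Fin n, (((graphOf ω).neighborSet v \ G.neighborSet v).ncard : ℝ) ≤
            (1 / 3 - γ) * ((graphOf ω).neighborSet v).ncard) →
          ∃ (k : ℕ) (f : Fin k × Fin 3 → Fin n), Function.Injective f ∧
            (∀ (i : Fin k) (a b : Fin 3), a ≠ b → G.Adj (f (i, a)) (f (i, b))) ∧
            (n : ℝ) - 3 * k ≤ D / p n ^ 2}) atTop (𝓝 1) := by
  exact BLS.main γ hγ
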